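/- Assume in addition that Ω is bounded. Let u ∈ L^∞_loc(Ω) be a function which is nonnegative a.e. in Ω and is a subsolution of −Δu + |u|^{q−1}u = 0. Then there exists a solution v of the equation in Ω such that u ≤ v a.e. in Ω, and such that v ≤ U a.e. in Ω for every solution U of the equation satisfying u ≤ U a.e. in Ω; i.e., v is the minimal solution dominating u. -/

import Mathlib

open MeasureTheory Set Filter

noncomputable section

def laplacian {N : ℕ} (φ : EuclideanSpace ℝ (Fin N) → ℝ) (x : EuclideanSpace ℝ (Fin N)) : ℝ :=
  ∑ i : Fin N, iteratedFDeriv ℝ 2 φ x ![EuclideanSpace.single i 1, EuclideanSpace.single i 1]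

def IsTestFun {N : ℕ} (Ω : Set (EuclideanSpace ℝ (Fin N))) (φ : EuclideanSpace ℝ (Fin N) → ℝ) : Prop :=
  ContDiff ℝ (⊤ : ℕ∞) φ ∧ HasCompactSupport φ ∧ tsupport φ ⊆ Ω

def MemLqLoc {N : ℕ} (q : ℝ) (Ω : Set (EuclideanSpace ℝ (Fin N)))
    (u : EuclideanSpace ℝ (Fin N) → ℝ) : Prop :=
  AEStronglyMeasurable u (volume.restrict Ω) ∧
  ∀ K : Set (EuclideanSpace ℝ (Fin N)), K ⊆ Ω → IsCompact K →
    IntegrableOn (fun x => |u x| ^ q) K volume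

def MemLinftyLoc {N : ℕ} (Ω : Set (EuclideanSpace ℝ (Fin N)))
    (u : EuclideanSpace ℝ (Fin N) → ℝ) : Prop :=
  AEStronglyMeasurable u (volume.restrict Ω) ∧
  ∀ K : Set (EuclideanSpace ℝ (Fin N)), K ⊆ Ω → IsCompact K →
    ∃ M : ℝ, ∀ᵐ x ∂(volume.restrict K), |u x| ≤ M

def IsSubsolution {N : ℕ} (q : ℝ) (Ω : Set (EuclideanSpace ℝ (Fin N)))
    (u : EuclideanSpace ℝ (Fin N) → ℝ) : Prop :=
  MemLqLoc q Ω u ∧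
  ∀ φ : EuclideanSpace ℝ (Fin N) → ℝ, IsTestFun Ω φ → (∀ x, 0 ≤ φ x) →
    (∫ x in Ω, (-(u x) * laplacian φ x + |u x| ^ (q - 1) * u x * φ x)) ≤ 0

def IsSupersolution {N : ℕ} (q : ℝ) (Ω : Set (EuclideanSpace ℝ (Fin N)))
    (u : EuclideanSpace ℝ (Fin N) → ℝ) : Prop :=
  MemLqLoc q Ω u ∧
  ∀ φ : EuclideanSpace ℝ (Fin N) → ℝ, IsTestFun Ω φ → (∀ x, 0 ≤ φ x) →
    0 ≤ (∫ x in Ω, (-(u x) * laplacian φ x + |u x| ^ (q - 1) * u x * φ x))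

def IsSolution {N : ℕ} (q : ℝ) (Ω : Set (EuclideanSpace ℝ (Fin N)))
    (u : EuclideanSpace ℝ (Fin N) → ℝ) : Prop :=
  MemLqLoc q Ω u ∧
  ∀ φ : EuclideanSpace ℝ (Fin N) → ℝ, IsTestFun Ω φ →
    (∫ x in Ω, (-(u x) * laplacian φ x + |u x| ^ (q - 1) * u x * φ x)) = 0

open scoped Topology Convolution ENNReal

/-- The space `ℝ^N` with its Euclidean norm. -/
abbrev Euc (N : ℕ) := EuclideanSpace ℝ (Fin N)

/-- The `i`-th partial derivative of `f`. -/
def pderiv {N : ℕ} (i : Fin N) (f : Euc N → ℝ) (x : Euc N) : ℝ :=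
  fderiv ℝ f x (EuclideanSpace.single i 1)

section Calculus

variable {N : ℕ} {f g φ ψ : Euc N → ℝ} {D Ω : Set (Euc N)}

lemma contDiff_pderiv (hf : ContDiff ℝ (⊤ : ℕ∞) f) (i : Fin N) :
    ContDiff ℝ (⊤ : ℕ∞) (pderiv i f) := by
  unfold pderiv
  exact (hf.fderiv_right (m := (⊤ : ℕ∞)) (by simp)).clm_apply contDiff_const

lemma laplacian_eq_sum (hf : ContDiff ℝ (⊤ : ℕ∞) f) (x : Euc N) :
    laplacian f x = ∑ i, pderiv i (pderiv i f) x := by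
  unfold laplacian
  refine Finset.sum_congr rfl fun i _ => ?_
  rw [iteratedFDeriv_two_apply]
  have hd : DifferentiableAt ℝ (fderiv ℝ f) x :=
    ((hf.fderiv_right (m := (⊤ : ℕ∞)) (by simp)).differentiable (by simp)).differentiableAt
  unfold pderiv
  rw [fderiv_clm_apply hd (differentiableAt_const _)]
  simp

lemma contDiff_laplacian (hf : ContDiff ℝ (⊤ : ℕ∞) f) :
    ContDiff ℝ (⊤ : ℕ∞) (laplacian f) := by
  rw [funext (laplacian_eq_sum hf)]
  exact ContDiff.sum fun i _ => contDiff_pderiv (contDiff_pderiv hf i) i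

lemma support_pderiv_subset (i : Fin N) : Function.support (pderiv i f) ⊆ tsupport f := by
  intro x hx
  by_contra h
  apply hx
  have : fderiv ℝ f x = 0 := by
    by_contra h2
    exact h (support_fderiv_subset ℝ h2)
  simp [pderiv, this]

lemma tsupport_pderiv_subset (i : Fin N) : tsupport (pderiv i f) ⊆ tsupport f :=
  closure_minimal (support_pderiv_subset i) (isClosed_tsupport f)

lemma tsupport_laplacian_subset : tsupport (laplacian f) ⊆ tsupport f := by
  refine closure_minimal (fun x hx => ?_) (isClosed_tsupport f)
  by_contra h
  apply hx
  have h3 : iteratedFDeriv ℝ 2 f x = 0 := by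
    by_contra h2
    exact h (support_iteratedFDeriv_subset 2 h2)
  simp [laplacian, h3]

lemma hasCompactSupport_pderiv (hf : HasCompactSupport f) (i : Fin N) :
    HasCompactSupport (pderiv i f) :=
  hf.mono' (support_pderiv_subset i)

lemma hasCompactSupport_laplacian (hf : HasCompactSupport f) :
    HasCompactSupport (laplacian f) :=
  hf.mono' ((subset_tsupport _).trans tsupport_laplacian_subset)

lemma laplacian_eq_zero_of_notMem_tsupport {x : Euc N} (hx : x ∉ tsupport f) :
    laplacian f x = 0 :=
  image_eq_zero_of_notMem_tsupport fun h => hx (tsupport_laplacian_subset h)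

lemma pderiv_const_mul (hf : ContDiff ℝ (⊤ : ℕ∞) f) (c : ℝ) (i : Fin N) :
    pderiv i (fun x => c * f x) = fun x => c * pderiv i f x := by
  ext x
  unfold pderiv
  rw [fderiv_const_mul (hf.differentiable (by simp) x)]
  rfl

lemma pderiv_mul (hf : ContDiff ℝ (⊤ : ℕ∞) f) (hg : ContDiff ℝ (⊤ : ℕ∞) g) (i : Fin N) :
    pderiv i (fun x => f x * g x) = fun x => f x * pderiv i g x + pderiv i f x * g x := by
  ext x
  unfold pderiv
  rw [fderiv_fun_mul (hf.differentiable (by simp) x) (hg.differentiable (by simp) x)]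
  simp [mul_comm]

lemma pderiv_comp {m : ℝ → ℝ} (hm : ContDiff ℝ (⊤ : ℕ∞) m) (hf : ContDiff ℝ (⊤ : ℕ∞) f)
    (i : Fin N) : pderiv i (fun x => m (f x)) = fun x => deriv m (f x) * pderiv i f x := by
  ext x
  unfold pderiv
  have h1 : HasDerivAt m (deriv m (f x)) (f x) :=
    ((hm.differentiable (by simp)) (f x)).hasDerivAt
  have h2 := (hf.differentiable (by simp) x).hasFDerivAt
  have := h1.comp_hasFDerivAt x h2
  rw [show (fun x => m (f x)) = m ∘ f from rfl, this.fderiv]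
  simp

lemma contDiff_deriv {m : ℝ → ℝ} (hm : ContDiff ℝ (⊤ : ℕ∞) m) :
    ContDiff ℝ (⊤ : ℕ∞) (deriv m) := by
  rw [show ((⊤ : ℕ∞) : WithTop ℕ∞) = ((⊤ : ℕ∞) : WithTop ℕ∞) + 1 by simp] at hm
  exact ((contDiff_succ_iff_deriv).1 hm).2.2

lemma laplacian_comp {m : ℝ → ℝ} (hm : ContDiff ℝ (⊤ : ℕ∞) m) (hf : ContDiff ℝ (⊤ : ℕ∞) f)
    (x : Euc N) : laplacian (fun x => m (f x)) x =
      deriv m (f x) * laplacian f x + deriv (deriv m) (f x) * ∑ i, (pderiv i f x) ^ 2 := by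
  rw [laplacian_eq_sum (f := fun x => m (f x)) (hm.comp hf), laplacian_eq_sum hf,
    Finset.mul_sum, Finset.mul_sum,
    ← Finset.sum_add_distrib]
  refine Finset.sum_congr rfl fun i _ => ?_
  have hm' := contDiff_deriv hm
  rw [pderiv_comp hm hf, pderiv_mul (f := fun x => deriv m (f x)) (hm'.comp hf)
    (contDiff_pderiv hf i), pderiv_comp hm' hf]
  ring

lemma integrable_mul_of_hasCompactSupport (hf : Continuous f) (hg : Continuous g)
    (hgc : HasCompactSupport g) : Integrable (fun x => f x * g x) :=
  (hf.mul hg).integrable_of_hasCompactSupport hgc.mul_left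

lemma integral_mul_pderiv (hf : ContDiff ℝ (⊤ : ℕ∞) f) (hg : ContDiff ℝ (⊤ : ℕ∞) g)
    (hgc : HasCompactSupport g) (i : Fin N) :
    ∫ x, f x * pderiv i g x = -∫ x, pderiv i f x * g x :=
  integral_mul_fderiv_eq_neg_fderiv_mul_of_integrable
    (integrable_mul_of_hasCompactSupport (contDiff_pderiv hf i).continuous hg.continuous hgc)
    (integrable_mul_of_hasCompactSupport hf.continuous (contDiff_pderiv hg i).continuous
      (hasCompactSupport_pderiv hgc i))
    (integrable_mul_of_hasCompactSupport hf.continuous hg.continuous hgc)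
    (fun x _ => hf.differentiable (by simp) x) (fun x _ => hg.differentiable (by simp) x)

lemma integral_mul_laplacian (hf : ContDiff ℝ (⊤ : ℕ∞) f) (hg : ContDiff ℝ (⊤ : ℕ∞) g)
    (hgc : HasCompactSupport g) :
    ∫ x, f x * laplacian g x = -∫ x, ∑ i, pderiv i f x * pderiv i g x := by
  simp_rw [laplacian_eq_sum hg, Finset.mul_sum]
  rw [integral_finsetSum, integral_finsetSum, ← Finset.sum_neg_distrib]
  · exact Finset.sum_congr rfl fun i _ =>
      integral_mul_pderiv hf (contDiff_pderiv hg i) (hasCompactSupport_pderiv hgc i) i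
  · exact fun i _ => integrable_mul_of_hasCompactSupport (contDiff_pderiv hf i).continuous
      (contDiff_pderiv hg i).continuous (hasCompactSupport_pderiv hgc i)
  · exact fun i _ => integrable_mul_of_hasCompactSupport hf.continuous
      (contDiff_pderiv (contDiff_pderiv hg i) i).continuous
      (hasCompactSupport_pderiv (hasCompactSupport_pderiv hgc i) i)

lemma integral_laplacian_mul (hf : ContDiff ℝ (⊤ : ℕ∞) f) (hg : ContDiff ℝ (⊤ : ℕ∞) g)
    (hgc : HasCompactSupport g) :
    ∫ x, f x * laplacian g x = ∫ x, laplacian f x * g x := by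
  rw [integral_mul_laplacian hf hg hgc]
  simp_rw [laplacian_eq_sum hf, Finset.sum_mul]
  rw [integral_finsetSum, integral_finsetSum, ← Finset.sum_neg_distrib]
  · refine Finset.sum_congr rfl fun i _ => ?_
    rw [integral_mul_pderiv (contDiff_pderiv hf i) hg hgc i, neg_neg]
  · exact fun i _ => integrable_mul_of_hasCompactSupport
      (contDiff_pderiv (contDiff_pderiv hf i) i).continuous hg.continuous hgc
  · exact fun i _ => integrable_mul_of_hasCompactSupport (contDiff_pderiv hf i).continuous
      (contDiff_pderiv hg i).continuous (hasCompactSupport_pderiv hgc i)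

lemma pderiv_comp_sub_left (hf : ContDiff ℝ (⊤ : ℕ∞) f) (x : Euc N) (i : Fin N) :
    pderiv i (fun y => f (x - y)) = fun y => -pderiv i f (x - y) := by
  ext y
  unfold pderiv
  have h2 := (hf.differentiable (by simp) (x - y)).hasFDerivAt
  have h1 : HasFDerivAt (fun y => x - y) (-ContinuousLinearMap.id ℝ (Euc N)) y := by
    exact (hasFDerivAt_id y).const_sub x
  rw [show (fun y => f (x - y)) = f ∘ (fun y => x - y) from rfl, (h2.comp y h1).fderiv]
  simp

lemma laplacian_comp_sub_left (hf : ContDiff ℝ (⊤ : ℕ∞) f) (x y : Euc N) :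
    laplacian (fun y => f (x - y)) y = laplacian f (x - y) := by
  rw [laplacian_eq_sum (f := fun y => f (x - y)) (hf.comp (contDiff_const.sub contDiff_id)),
    laplacian_eq_sum hf]
  refine Finset.sum_congr rfl fun i _ => ?_
  have hg := contDiff_pderiv hf i
  rw [pderiv_comp_sub_left hf]
  have : (fun y => -pderiv i f (x - y)) = fun y => (-1) * pderiv i f (x - y) := by
    ext; ring
  rw [this, pderiv_const_mul (f := fun y => pderiv i f (x - y))
    (hg.comp (contDiff_const.sub contDiff_id)),
    pderiv_comp_sub_left hg]
  ring

end Calculus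

/-! ### Test functions -/

section TestFun

variable {N : ℕ} {φ ψ : Euc N → ℝ} {D Ω : Set (Euc N)}

lemma IsTestFun.continuous (h : IsTestFun Ω φ) : Continuous φ := h.1.continuous

lemma IsTestFun.mono (h : IsTestFun D φ) (hD : D ⊆ Ω) : IsTestFun Ω φ :=
  ⟨h.1, h.2.1, h.2.2.trans hD⟩

lemma IsTestFun.eq_zero (h : IsTestFun Ω φ) {x : Euc N} (hx : x ∉ Ω) : φ x = 0 :=
  image_eq_zero_of_notMem_tsupport fun h' => hx (h.2.2 h')

lemma IsTestFun.laplacian (h : IsTestFun Ω φ) : IsTestFun Ω (laplacian φ) :=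
  ⟨contDiff_laplacian h.1, hasCompactSupport_laplacian h.2.1, tsupport_laplacian_subset.trans h.2.2⟩

lemma IsTestFun.add (h : IsTestFun Ω φ) (h' : IsTestFun Ω ψ) :
    IsTestFun Ω (fun x => φ x + ψ x) :=
  ⟨h.1.add h'.1, h.2.1.add h'.2.1, (tsupport_add φ ψ).trans (union_subset h.2.2 h'.2.2)⟩

lemma IsTestFun.const_mul (h : IsTestFun Ω φ) (c : ℝ) : IsTestFun Ω (fun x => c * φ x) :=
  ⟨contDiff_const.mul h.1, h.2.1.mul_left, (tsupport_mul_subset_right).trans h.2.2⟩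

lemma IsTestFun.integrable (h : IsTestFun Ω φ) : Integrable φ :=
  h.continuous.integrable_of_hasCompactSupport h.2.1

lemma IsTestFun.exists_bound (h : IsTestFun Ω φ) : ∃ C, 0 ≤ C ∧ ∀ x, |φ x| ≤ C := by
  obtain ⟨C, hC⟩ := h.continuous.bounded_above_of_compact_support h.2.1
  exact ⟨C, (norm_nonneg _).trans (hC 0), hC⟩

lemma exists_isTestFun_eq_one {K : Set (Euc N)} (hΩ : IsOpen Ω) (hK : IsCompact K)
    (hKΩ : K ⊆ Ω) :
    ∃ φ, IsTestFun Ω φ ∧ (∀ x, 0 ≤ φ x) ∧ (∀ x, φ x ≤ 1) ∧ ∀ x ∈ K, φ x = 1 := by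
  obtain ⟨δ, hδ, hδΩ⟩ := hK.exists_cthickening_subset_open hΩ hKΩ
  obtain ⟨f, hf, hr, hs, h1⟩ := exists_contMDiff_support_eq_eq_one_iff
    (modelWithCornersSelf ℝ (Euc N)) (n := ⊤) (Metric.isOpen_thickening (δ := δ) (E := K))
    hK.isClosed (Metric.self_subset_thickening hδ K)
  have hsub : tsupport f ⊆ Metric.cthickening δ K := by
    rw [tsupport, hs]; exact Metric.closure_thickening_subset_cthickening δ K
  exact ⟨f, ⟨contMDiff_iff_contDiff.1 hf,
    hK.cthickening.of_isClosed_subset (isClosed_tsupport f) hsub, hsub.trans hδΩ⟩,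
    fun x => (hr ⟨x, rfl⟩).1, fun x => (hr ⟨x, rfl⟩).2, fun x hx => (h1 x).1 hx⟩

end TestFun

/-! ### A smooth convex substitute for the positive part -/

/-- A smooth convex function which vanishes on `(-∞, 0]` and has slope one on `[ε, ∞)`. -/
def smoothPos (ε t : ℝ) : ℝ := ∫ s in (0 : ℝ)..t, Real.smoothTransition (s / ε)

section SmoothPos

variable {ε t : ℝ}

lemma continuous_smoothTransition_div (ε : ℝ) :
    Continuous fun s : ℝ => Real.smoothTransition (s / ε) :=
  Real.smoothTransition.continuous.comp (continuous_id.div_const ε)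

lemma hasDerivAt_smoothPos (ε t : ℝ) :
    HasDerivAt (smoothPos ε) (Real.smoothTransition (t / ε)) t :=
  (continuous_smoothTransition_div ε).integral_hasStrictDerivAt 0 t |>.hasDerivAt

lemma deriv_smoothPos (ε : ℝ) :
    deriv (smoothPos ε) = fun t => Real.smoothTransition (t / ε) :=
  funext fun t => (hasDerivAt_smoothPos ε t).deriv

lemma contDiff_smoothPos (ε : ℝ) : ContDiff ℝ (⊤ : ℕ∞) (smoothPos ε) := by
  rw [show ((⊤ : ℕ∞) : WithTop ℕ∞) = ((⊤ : ℕ∞) : WithTop ℕ∞) + 1 by simp,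
    contDiff_succ_iff_deriv]
  refine ⟨fun t => (hasDerivAt_smoothPos ε t).differentiableAt, by simp, ?_⟩
  rw [deriv_smoothPos]
  exact Real.smoothTransition.contDiff.comp (contDiff_id.div_const ε)

lemma deriv_deriv_smoothPos_nonneg (hε : 0 < ε) (t : ℝ) : 0 ≤ deriv (deriv (smoothPos ε)) t := by
  rw [deriv_smoothPos]
  refine Monotone.deriv_nonneg fun a b hab => Real.smoothTransition.monotone ?_
  gcongr

lemma deriv_smoothPos_nonneg (ε t : ℝ) : 0 ≤ deriv (smoothPos ε) t := by
  rw [deriv_smoothPos]; exact Real.smoothTransition.nonneg _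

lemma deriv_smoothPos_le_one (ε t : ℝ) : deriv (smoothPos ε) t ≤ 1 := by
  rw [deriv_smoothPos]; exact Real.smoothTransition.le_one _

lemma deriv_smoothPos_of_nonpos (hε : 0 < ε) (ht : t ≤ 0) : deriv (smoothPos ε) t = 0 := by
  rw [deriv_smoothPos]
  exact Real.smoothTransition.zero_of_nonpos (div_nonpos_of_nonpos_of_nonneg ht hε.le)

lemma smoothPos_of_nonpos (hε : 0 < ε) (ht : t ≤ 0) : smoothPos ε t = 0 := by
  unfold smoothPos
  rw [intervalIntegral.integral_congr (g := fun _ => 0)]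
  · simp
  · intro s hs
    rw [uIcc_of_ge ht] at hs
    exact Real.smoothTransition.zero_of_nonpos (div_nonpos_of_nonpos_of_nonneg hs.2 hε.le)

lemma smoothPos_nonneg (hε : 0 < ε) (t : ℝ) : 0 ≤ smoothPos ε t := by
  rcases le_total t 0 with h | h
  · exact (smoothPos_of_nonpos hε h).ge
  · exact intervalIntegral.integral_nonneg h fun _ _ => Real.smoothTransition.nonneg _

lemma smoothPos_pos (hε : 0 < ε) (ht : 0 < t) : 0 < smoothPos ε t :=
  intervalIntegral.intervalIntegral_pos_of_pos_on
    ((continuous_smoothTransition_div ε).intervalIntegrable _ _)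
    (fun _ hs => Real.smoothTransition.pos_of_pos (div_pos hs.1 hε)) ht

lemma smoothPos_le_deriv_mul (hε : 0 < ε) (t : ℝ) :
    smoothPos ε t ≤ deriv (smoothPos ε) t * max t 0 := by
  rcases le_total t 0 with h | h
  · simp [smoothPos_of_nonpos hε h, h]
  · rw [max_eq_left h, deriv_smoothPos]
    calc smoothPos ε t ≤ ∫ s in (0 : ℝ)..t, Real.smoothTransition (t / ε) := by
          refine intervalIntegral.integral_mono_on h
            ((continuous_smoothTransition_div ε).intervalIntegrable _ _)
            (by simp) fun s hs => Real.smoothTransition.monotone ?_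
          have := hs.2
          gcongr
      _ = _ := by simp [mul_comm]

lemma smoothPos_le_max (hε : 0 < ε) (t : ℝ) : smoothPos ε t ≤ max t 0 :=
  (smoothPos_le_deriv_mul hε t).trans
    (mul_le_of_le_one_left (le_max_right _ _) (deriv_smoothPos_le_one _ _))

lemma abs_smoothPos_le (hε : 0 < ε) (t : ℝ) : |smoothPos ε t| ≤ |t| := by
  rw [abs_of_nonneg (smoothPos_nonneg hε t)]
  exact (smoothPos_le_max hε t).trans (max_le (le_abs_self t) (abs_nonneg t))

lemma max_sub_le_smoothPos (hε : 0 < ε) (t : ℝ) : max t 0 - ε ≤ smoothPos ε t := by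
  rcases le_total t ε with h | h
  · have : max t 0 ≤ ε := max_le h hε.le
    linarith [smoothPos_nonneg hε t]
  · have h1 : ∫ s in ε..t, Real.smoothTransition (s / ε) = t - ε := by
      rw [intervalIntegral.integral_congr (g := fun _ => 1)]
      · simp
      · intro s hs
        rw [uIcc_of_le h] at hs
        exact Real.smoothTransition.one_of_one_le ((one_le_div hε).2 hs.1)
    have h2 := intervalIntegral.integral_add_adjacent_intervals
      ((continuous_smoothTransition_div ε).intervalIntegrable (μ := volume) 0 ε)
      ((continuous_smoothTransition_div ε).intervalIntegrable ε t)
    have h3 : 0 ≤ ∫ s in (0 : ℝ)..ε, Real.smoothTransition (s / ε) := smoothPos_nonneg hε ε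
    rw [max_eq_left (hε.le.trans h)]
    unfold smoothPos
    linarith

lemma lipschitzWith_smoothPos (ε : ℝ) : LipschitzWith 1 (smoothPos ε) := by
  refine lipschitzWith_of_nnnorm_deriv_le
    (fun t => (hasDerivAt_smoothPos ε t).differentiableAt) fun t => ?_
  rw [← NNReal.coe_le_coe, coe_nnnorm, Real.norm_of_nonneg (deriv_smoothPos_nonneg ε t)]
  exact deriv_smoothPos_le_one ε t

lemma continuous_smoothPos (ε : ℝ) : Continuous (smoothPos ε) :=
  (lipschitzWith_smoothPos ε).continuous

end SmoothPos

/-! ### Mollification -/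

section Mollify

variable {N : ℕ} {f g : Euc N → ℝ} {Ω : Set (Euc N)}

/-- The convolution of `f` with the normalised bump function `ρ`. -/
def mollify (ρ : ContDiffBump (0 : Euc N)) (f : Euc N → ℝ) : Euc N → ℝ :=
  ρ.normed volume ⋆[ContinuousLinearMap.lsmul ℝ ℝ, volume] f

lemma convolution_lsmul_swap (k f : Euc N → ℝ) (x : Euc N) :
    (k ⋆[ContinuousLinearMap.lsmul ℝ ℝ, volume] f) x = ∫ y, k (x - y) * f y := by
  rw [convolution_eq_swap]; rfl

lemma mollify_apply (ρ : ContDiffBump (0 : Euc N)) (f : Euc N → ℝ) (x : Euc N) :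
    mollify ρ f x = ∫ y, ρ.normed volume (x - y) * f y :=
  convolution_lsmul_swap _ _ _

lemma integrable_comp_sub_left_mul {k : Euc N → ℝ} (hk : Continuous k) (hkc : HasCompactSupport k)
    (hf : Integrable f) (x : Euc N) : Integrable fun y => k (x - y) * f y := by
  obtain ⟨C, hC⟩ := hk.bounded_above_of_compact_support hkc
  exact hf.bdd_mul (c := C) (hk.comp (continuous_const.sub continuous_id)).aestronglyMeasurable
    (ae_of_all _ fun y => hC _)

lemma pderiv_convolution {k : Euc N → ℝ} (hk : ContDiff ℝ (⊤ : ℕ∞) k) (hkc : HasCompactSupport k)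
    (hf : Integrable f) (i : Fin N) :
    pderiv i (k ⋆[ContinuousLinearMap.lsmul ℝ ℝ, volume] f) =
      pderiv i k ⋆[ContinuousLinearMap.lsmul ℝ ℝ, volume] f := by
  ext x
  have h1 := hkc.hasFDerivAt_convolution_left (ContinuousLinearMap.lsmul ℝ ℝ)
    (hk.of_le (by exact_mod_cast le_top)) hf.locallyIntegrable x
  unfold pderiv
  rw [h1.fderiv, convolution_eq_swap, convolution_lsmul_swap,
    ContinuousLinearMap.integral_apply]
  · rfl
  · have hd : Continuous (fderiv ℝ k) := hk.continuous_fderiv (by simp)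
    obtain ⟨C, hC⟩ := hd.bounded_above_of_compact_support (hkc.fderiv ℝ)
    have h2 : Integrable fun y => f y • fderiv ℝ k (x - y) :=
      hf.smul_bdd C
        (hd.comp (continuous_const.sub continuous_id)).aestronglyMeasurable
        (ae_of_all _ fun y => hC _)
    refine h2.congr (ae_of_all _ fun y => ?_)
    ext v
    simp [ContinuousLinearMap.precompL_apply, mul_comm]

lemma contDiff_normed (ρ : ContDiffBump (0 : Euc N)) :
    ContDiff ℝ (⊤ : ℕ∞) (ρ.normed volume) := ρ.contDiff_normed

lemma contDiff_mollify (ρ : ContDiffBump (0 : Euc N)) (hf : Integrable f) :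
    ContDiff ℝ (⊤ : ℕ∞) (mollify ρ f) :=
  ρ.hasCompactSupport_normed.contDiff_convolution_left _ (contDiff_normed ρ) hf.locallyIntegrable

lemma laplacian_mollify (ρ : ContDiffBump (0 : Euc N)) (hf : Integrable f) (x : Euc N) :
    laplacian (mollify ρ f) x = ∫ y, laplacian (ρ.normed volume) (x - y) * f y := by
  have hρ := contDiff_normed ρ
  have hc : HasCompactSupport (ρ.normed volume) := ρ.hasCompactSupport_normed
  rw [laplacian_eq_sum (contDiff_mollify ρ hf)]
  simp_rw [laplacian_eq_sum hρ, Finset.sum_mul]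
  rw [integral_finsetSum]
  · refine Finset.sum_congr rfl fun i _ => ?_
    unfold mollify
    rw [pderiv_convolution hρ hc hf, pderiv_convolution (contDiff_pderiv hρ i)
      (hasCompactSupport_pderiv hc i) hf, convolution_lsmul_swap]
  · exact fun i _ => integrable_comp_sub_left_mul (contDiff_pderiv (contDiff_pderiv hρ i) i).continuous
      (hasCompactSupport_pderiv (hasCompactSupport_pderiv hc i) i) hf x

lemma mollify_le (ρ : ContDiffBump (0 : Euc N)) (hf : Integrable f) {C : ℝ} (h : ∀ x, f x ≤ C)
    (x : Euc N) : mollify ρ f x ≤ C := by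
  rw [mollify_apply]
  have h1 : ∫ y, ρ.normed volume (x - y) = 1 := by
    rw [integral_sub_left_eq_self (fun y => ρ.normed volume y) volume x]; exact ρ.integral_normed
  calc ∫ y, ρ.normed volume (x - y) * f y ≤ ∫ y, ρ.normed volume (x - y) * C := by
        refine integral_mono (integrable_comp_sub_left_mul ρ.continuous_normed
          ρ.hasCompactSupport_normed hf x) ?_ fun y =>
            mul_le_mul_of_nonneg_left (h y) (ρ.nonneg_normed _)
        exact (ρ.integrable_normed.comp_sub_left x).mul_const C
    _ = C := by rw [integral_mul_const, h1, one_mul]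

lemma mollify_neg (ρ : ContDiffBump (0 : Euc N)) (f : Euc N → ℝ) (x : Euc N) :
    mollify ρ (fun x => -f x) x = -mollify ρ f x := by
  simp [mollify_apply, integral_neg]

lemma mollify_sub (ρ : ContDiffBump (0 : Euc N)) (hf : Integrable f) (hg : Integrable g)
    (x : Euc N) : mollify ρ (fun x => f x - g x) x = mollify ρ f x - mollify ρ g x := by
  simp_rw [mollify_apply, mul_sub]
  exact integral_sub
    (integrable_comp_sub_left_mul ρ.continuous_normed ρ.hasCompactSupport_normed hf x)
    (integrable_comp_sub_left_mul ρ.continuous_normed ρ.hasCompactSupport_normed hg x)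

lemma abs_mollify_le (ρ : ContDiffBump (0 : Euc N)) (hf : Integrable f) {C : ℝ}
    (h : ∀ x, |f x| ≤ C) (x : Euc N) : |mollify ρ f x| ≤ C := by
  refine abs_le.2 ⟨?_, mollify_le ρ hf (fun x => (abs_le.1 (h x)).2) x⟩
  have := mollify_le ρ hf.neg (C := C) (fun x => by
    have := (abs_le.1 (h x)).1
    simp only [Pi.neg_apply]; linarith) x
  have h2 := mollify_neg ρ f x
  simp only [Pi.neg_def] at this
  linarith

lemma integrable_mollify (ρ : ContDiffBump (0 : Euc N)) (hf : Integrable f) :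
    Integrable (mollify ρ f) :=
  ρ.integrable_normed.integrable_convolution _ hf

lemma integral_mollify (ρ : ContDiffBump (0 : Euc N)) (hf : Integrable f) :
    ∫ x, mollify ρ f x = ∫ x, f x := by
  unfold mollify
  rw [integral_convolution _ ρ.integrable_normed hf, ρ.integral_normed]
  simp

/-- A sequence of bump functions shrinking to the origin. -/
def bumpSeq (N : ℕ) (δ : ℝ) (hδ : 0 < δ) (n : ℕ) : ContDiffBump (0 : Euc N) where
  rIn := δ / (2 * (n + 1))
  rOut := δ / (n + 1)
  rIn_pos := by positivity
  rIn_lt_rOut := by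
    apply div_lt_div_of_pos_left hδ (by positivity)
    have : (0 : ℝ) ≤ n := by positivity
    linarith

lemma bumpSeq_rOut_le (δ : ℝ) (hδ : 0 < δ) (n : ℕ) : (bumpSeq N δ hδ n).rOut ≤ δ := by
  show δ / (n + 1) ≤ δ
  apply div_le_self hδ.le
  have : (0 : ℝ) ≤ n := by positivity
  linarith

lemma ae_tendsto_mollify (δ : ℝ) (hδ : 0 < δ) (hf : Integrable f) :
    ∀ᵐ x, Tendsto (fun n => mollify (bumpSeq N δ hδ n) f x) atTop (𝓝 (f x)) := by
  refine ContDiffBump.ae_convolution_tendsto_right_of_locallyIntegrable (K := 2) ?_ ?_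
    hf.locallyIntegrable
  · exact tendsto_const_nhds.div_atTop
      (tendsto_atTop_add_const_right _ _ tendsto_natCast_atTop_atTop)
  · refine Eventually.of_forall fun n => le_of_eq ?_
    show δ / (n + 1) = 2 * (δ / (2 * (n + 1)))
    field_simp

lemma tendsto_integral_abs_mollify_sub_of_nonneg (δ : ℝ) (hδ : 0 < δ) (hf : Integrable f)
    (h0 : ∀ x, 0 ≤ f x) :
    Tendsto (fun n => ∫ x, |mollify (bumpSeq N δ hδ n) f x - f x|) atTop (𝓝 0) := by
  have hn : ∀ n x, 0 ≤ mollify (bumpSeq N δ hδ n) f x := fun n x => by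
    rw [mollify_apply]
    exact integral_nonneg fun y => mul_nonneg (ContDiffBump.nonneg_normed _ _) (h0 y)
  have key : ∀ n, ∫ x, |mollify (bumpSeq N δ hδ n) f x - f x| =
      2 * ∫ x, max (f x - mollify (bumpSeq N δ hδ n) f x) 0 := fun n => by
    have hi := integrable_mollify (bumpSeq N δ hδ n) hf
    have e : ∀ x, |mollify (bumpSeq N δ hδ n) f x - f x| =
        2 * max (f x - mollify (bumpSeq N δ hδ n) f x) 0 +
          (mollify (bumpSeq N δ hδ n) f x - f x) := fun x => by
      rcases le_total (f x) (mollify (bumpSeq N δ hδ n) f x) with h | h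
      · rw [abs_of_nonneg (by linarith), max_eq_right (by linarith)]; ring
      · rw [abs_of_nonpos (by linarith), max_eq_left (by linarith)]; ring
    simp_rw [e]
    rw [integral_add (f := fun x => 2 * max (f x - mollify (bumpSeq N δ hδ n) f x) 0)
      (g := fun x => mollify (bumpSeq N δ hδ n) f x - f x)
      (((hf.sub hi).pos_part).const_mul 2) (hi.sub hf), integral_const_mul,
      integral_sub hi hf, integral_mollify _ hf]
    simp
  simp_rw [key]
  have : Tendsto (fun n => ∫ x, max (f x - mollify (bumpSeq N δ hδ n) f x) 0) atTop
      (𝓝 (∫ x : Euc N, (0 : ℝ))) := by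
    refine tendsto_integral_of_dominated_convergence f
      (fun n => ((hf.sub (integrable_mollify _ hf)).pos_part).aestronglyMeasurable) hf
      (fun n => ae_of_all _ fun x => ?_) ?_
    · rw [Real.norm_of_nonneg (le_max_right _ _)]
      exact max_le (by linarith [hn n x]) (h0 x)
    · filter_upwards [ae_tendsto_mollify δ hδ hf] with x hx
      have := (tendsto_const_nhds (x := f x)).sub hx
      simpa using this.max (tendsto_const_nhds (x := (0 : ℝ)))
  simpa using this.const_mul 2

lemma tendsto_integral_abs_mollify_sub (δ : ℝ) (hδ : 0 < δ) (hf : Integrable f) :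
    Tendsto (fun n => ∫ x, |mollify (bumpSeq N δ hδ n) f x - f x|) atTop (𝓝 0) := by
  have hp := hf.pos_part
  have hm := hf.neg_part
  have h1 := tendsto_integral_abs_mollify_sub_of_nonneg δ hδ hp fun x => le_max_right _ _
  have h2 := tendsto_integral_abs_mollify_sub_of_nonneg δ hδ hm fun x => le_max_right _ _
  have h3 := h1.add h2
  rw [add_zero] at h3
  refine squeeze_zero (fun n => integral_nonneg fun x => abs_nonneg _) (fun n => ?_) h3
  have i1 := ((integrable_mollify (bumpSeq N δ hδ n) hp).sub hp).abs
  have i2 := ((integrable_mollify (bumpSeq N δ hδ n) hm).sub hm).abs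
  refine (integral_mono ((integrable_mollify _ hf).sub hf).abs (i1.add i2) fun x => ?_).trans_eq
    (integral_add i1 i2)
  have e : f = fun x => max (f x) 0 - max (-f x) 0 := by
    ext x; exact (max_zero_sub_max_neg_zero_eq_self (f x)).symm
  have e2 := mollify_sub (bumpSeq N δ hδ n) hp hm x
  rw [← e] at e2
  have e3 : f x = max (f x) 0 - max (-f x) 0 := congrFun e x
  simp only [Pi.add_apply, Pi.sub_apply]
  calc |mollify (bumpSeq N δ hδ n) f x - f x|
      = |(mollify (bumpSeq N δ hδ n) (fun x => max (f x) 0) x - max (f x) 0) -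
        (mollify (bumpSeq N δ hδ n) (fun x => max (-f x) 0) x - max (-f x) 0)| := by
          congr 1; rw [e2]; linarith
    _ ≤ _ := abs_sub _ _

end Mollify

section NegLapLE

variable {N : ℕ} {f g : Euc N → ℝ} {K Ω : Set (Euc N)}

/-- `-Δ g ≤ f` in `Ω`, in the sense of distributions. -/
def NegLapLE (Ω : Set (Euc N)) (g f : Euc N → ℝ) : Prop :=
  (∀ K ⊆ Ω, IsCompact K → IntegrableOn g K) ∧ (∀ K ⊆ Ω, IsCompact K → IntegrableOn f K) ∧
    ∀ φ, IsTestFun Ω φ → (∀ x, 0 ≤ φ x) →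
      ∫ x, -(g x) * laplacian φ x ≤ ∫ x, f x * φ x

lemma NegLapLE.exists_approx (h : NegLapLE Ω g f) (hΩ : IsOpen Ω) (hK : IsCompact K)
    (hKΩ : K ⊆ Ω) :
    ∃ G F : ℕ → Euc N → ℝ, (∀ n, ContDiff ℝ (⊤ : ℕ∞) (G n)) ∧ (∀ n, ContDiff ℝ (⊤ : ℕ∞) (F n)) ∧
      (∀ n, ∀ x ∈ K, -laplacian (G n) x ≤ F n x) ∧
      (∀ᵐ x, x ∈ K → Tendsto (fun n => G n x) atTop (𝓝 (g x))) ∧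
      (∀ᵐ x, x ∈ K → Tendsto (fun n => F n x) atTop (𝓝 (f x))) ∧
      Tendsto (fun n => ∫ x in K, |G n x - g x|) atTop (𝓝 0) ∧
      Tendsto (fun n => ∫ x in K, |F n x - f x|) atTop (𝓝 0) ∧
      (∀ C, (∀ x, |g x| ≤ C) → ∀ n x, |G n x| ≤ C) ∧
      (∀ C, (∀ x, |f x| ≤ C) → ∀ n x, |F n x| ≤ C) ∧
      ((∀ x, g x ≤ 0) → ∀ n x, G n x ≤ 0) := by
  obtain ⟨δ, hδ, hδΩ⟩ := hK.exists_cthickening_subset_open hΩ hKΩ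
  set K' := Metric.cthickening δ K with hK'
  have hK'c : IsCompact K' := hK.cthickening
  have hK'm : MeasurableSet K' := hK'c.isClosed.measurableSet
  have hsub : K ⊆ K' := Metric.self_subset_cthickening K
  have hgi : Integrable (K'.indicator g) := (h.1 K' hδΩ hK'c).integrable_indicator hK'm
  have hfi : Integrable (K'.indicator f) := (h.2.1 K' hδΩ hK'c).integrable_indicator hK'm
  have hL1 : ∀ {k : Euc N → ℝ}, Integrable (K'.indicator k) →
      Tendsto (fun n => ∫ x in K, |mollify (bumpSeq N δ hδ n) (K'.indicator k) x - k x|) atTop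
        (𝓝 0) := fun {k} hk => by
    refine squeeze_zero (fun n => integral_nonneg fun x => abs_nonneg _) (fun n => ?_)
      (tendsto_integral_abs_mollify_sub δ hδ hk)
    have hi := ((integrable_mollify (bumpSeq N δ hδ n) hk).sub hk).abs
    rw [setIntegral_congr_fun (g := fun x => |mollify (bumpSeq N δ hδ n) (K'.indicator k) x -
      K'.indicator k x|) hK.isClosed.measurableSet fun x hx => by
        simp only [indicator_of_mem (hsub hx)]]
    exact setIntegral_le_integral hi (ae_of_all _ fun x => abs_nonneg _)
  have hbd : ∀ {k : Euc N → ℝ} (C : ℝ), (∀ x, |k x| ≤ C) → ∀ x, |K'.indicator k x| ≤ C := by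
    intro k C hC x
    by_cases hx : x ∈ K'
    · rw [indicator_of_mem hx]; exact hC x
    · rw [indicator_of_notMem hx, abs_zero]; exact (abs_nonneg _).trans (hC x)
  refine ⟨fun n => mollify (bumpSeq N δ hδ n) (K'.indicator g),
    fun n => mollify (bumpSeq N δ hδ n) (K'.indicator f), fun n => contDiff_mollify _ hgi,
    fun n => contDiff_mollify _ hfi, fun n x hx => ?_, ?_, ?_, hL1 hgi, hL1 hfi,
    fun C hC n x => abs_mollify_le _ hgi (hbd C hC) x,
    fun C hC n x => abs_mollify_le _ hfi (hbd C hC) x,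
    fun hg n x => mollify_le _ hgi (fun y => indicator_nonpos (fun y _ => hg y) y) x⟩
  · set ρ := bumpSeq N δ hδ n with hρ
    have hρs := contDiff_normed ρ
    have hts : tsupport (fun y => ρ.normed volume (x - y)) ⊆ K' := by
      refine closure_minimal (fun y hy => ?_) hK'c.isClosed
      have h1 : x - y ∈ Function.support (ρ.normed volume) := hy
      rw [ρ.support_normed_eq, Metric.mem_ball, dist_zero_right] at h1
      refine Metric.mem_cthickening_of_dist_le y x δ K hx ?_
      rw [dist_comm, dist_eq_norm]
      exact h1.le.trans (bumpSeq_rOut_le δ hδ n)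
    have htest : IsTestFun Ω (fun y => ρ.normed volume (x - y)) :=
      ⟨hρs.comp (contDiff_const.sub contDiff_id),
        hK'c.of_isClosed_subset (isClosed_tsupport _) hts, hts.trans hδΩ⟩
    have h3 := h.2.2 _ htest fun y => ρ.nonneg_normed _
    show -laplacian (mollify ρ (K'.indicator g)) x ≤ mollify ρ (K'.indicator f) x
    rw [laplacian_mollify _ hgi, mollify_apply, ← integral_neg]
    refine le_of_eq_of_le (integral_congr_ae (ae_of_all _ fun y => ?_))
      (h3.trans_eq (integral_congr_ae (ae_of_all _ fun y => ?_)))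
    · show -(laplacian (ρ.normed volume) (x - y) * K'.indicator g y) = _
      rw [laplacian_comp_sub_left hρs]
      by_cases hy : y ∈ K'
      · rw [indicator_of_mem hy]; ring
      · have h4 : laplacian (fun y => ρ.normed volume (x - y)) y = 0 :=
          laplacian_eq_zero_of_notMem_tsupport fun h' => hy (hts h')
        rw [laplacian_comp_sub_left hρs] at h4
        rw [h4]; ring
    · show f y * ρ.normed volume (x - y) = ρ.normed volume (x - y) * K'.indicator f y
      by_cases hy : y ∈ K'
      · rw [indicator_of_mem hy]; ring
      · have h4 : ρ.normed volume (x - y) = 0 :=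
          image_eq_zero_of_notMem_tsupport (f := fun y => ρ.normed volume (x - y))
            fun h' => hy (hts h')
        rw [h4]; ring
  · filter_upwards [ae_tendsto_mollify δ hδ hgi] with x hx hxK
    rwa [indicator_of_mem (hsub hxK)] at hx
  · filter_upwards [ae_tendsto_mollify δ hδ hfi] with x hx hxK
    rwa [indicator_of_mem (hsub hxK)] at hx

lemma tendsto_integral_mul_of_tendsto_L1 {a : Euc N → ℝ} {b : Euc N → ℝ} {A B : ℕ → Euc N → ℝ}
    {C : ℝ} (hK : MeasurableSet K) (hA : ∀ n, IntegrableOn (A n) K) (ha : IntegrableOn a K)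
    (hB : ∀ n, AEStronglyMeasurable (B n) (volume.restrict K)) (hBC : ∀ n x, |B n x| ≤ C)
    (hB0 : ∀ n, ∀ x ∉ K, B n x = 0) (hb0 : ∀ x ∉ K, b x = 0)
    (hAa : Tendsto (fun n => ∫ x in K, |A n x - a x|) atTop (𝓝 0))
    (hBb : ∀ᵐ x, x ∈ K → Tendsto (fun n => B n x) atTop (𝓝 (b x))) :
    Tendsto (fun n => ∫ x, A n x * B n x) atTop (𝓝 (∫ x, a x * b x)) := by
  have e1 : ∀ n, ∫ x, A n x * B n x = ∫ x in K, A n x * B n x := fun n =>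
    (setIntegral_eq_integral_of_forall_compl_eq_zero fun x hx => by rw [hB0 n x hx, mul_zero]).symm
  have e2 : ∫ x, a x * b x = ∫ x in K, a x * b x :=
    (setIntegral_eq_integral_of_forall_compl_eq_zero fun x hx => by rw [hb0 x hx, mul_zero]).symm
  simp_rw [e1, e2]
  have hi : ∀ n {k : Euc N → ℝ}, IntegrableOn k K → IntegrableOn (fun x => k x * B n x) K :=
    fun n k hk => hk.mul_bdd (c := C) (hB n) (ae_of_all _ fun x => hBC n x)
  have t1 : Tendsto (fun n => ∫ x in K, (A n x - a x) * B n x) atTop (𝓝 0) := by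
    refine squeeze_zero_norm (fun n => ?_) (by simpa using hAa.mul_const C)
    rw [← integral_mul_const]
    refine norm_integral_le_of_norm_le (((hA n).sub ha).abs.mul_const C) (ae_of_all _ fun x => ?_)
    rw [norm_mul]
    exact mul_le_mul_of_nonneg_left (hBC n x) (norm_nonneg _)
  have t2 : Tendsto (fun n => ∫ x in K, a x * B n x) atTop (𝓝 (∫ x in K, a x * b x)) := by
    refine tendsto_integral_of_dominated_convergence (fun x => |a x| * C)
      (fun n => (hi n ha).aestronglyMeasurable) (ha.abs.mul_const C)
      (fun n => ae_of_all _ fun x => ?_) ?_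
    · rw [norm_mul]
      exact mul_le_mul_of_nonneg_left (hBC n x) (norm_nonneg _)
    · rw [ae_restrict_iff' hK]
      filter_upwards [hBb] with x hx hxK using (hx hxK).const_mul _
  have := t1.add t2
  rw [zero_add] at this
  refine this.congr fun n => ?_
  rw [← integral_add (f := fun x => (A n x - a x) * B n x) (g := fun x => a x * B n x)
    (hi n ((hA n).sub ha)) (hi n ha)]
  exact integral_congr_ae (ae_of_all _ fun x => by simp only; ring)

/-- Kato's inequality. -/
lemma NegLapLE.smoothPos (h : NegLapLE Ω g f) (hΩ : IsOpen Ω) {ε : ℝ} (hε : 0 < ε) :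
    NegLapLE Ω (fun x => smoothPos ε (g x)) (fun x => deriv (smoothPos ε) (g x) * f x) := by
  have hm := contDiff_smoothPos ε
  have hm' := contDiff_deriv hm
  have hspi : ∀ {k : Euc N → ℝ} {K}, IntegrableOn k K →
      IntegrableOn (fun x => _root_.smoothPos ε (k x)) K := fun {k K} hk =>
    Integrable.mono hk ((continuous_smoothPos ε).comp_aestronglyMeasurable hk.aestronglyMeasurable)
      (ae_of_all _ fun x => abs_smoothPos_le hε _)
  refine ⟨fun K hK hKc => hspi (h.1 K hK hKc), fun K hK hKc => ?_, fun φ hφ hφ0 => ?_⟩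
  · refine (h.2.1 K hK hKc).bdd_mul (c := 1)
      (hm'.continuous.comp_aestronglyMeasurable (h.1 K hK hKc).aestronglyMeasurable)
      (ae_of_all _ fun x => ?_)
    rw [Real.norm_of_nonneg (deriv_smoothPos_nonneg ε _)]
    exact deriv_smoothPos_le_one ε _
  set K := tsupport φ with hK
  have hKc : IsCompact K := hφ.2.1
  have hKm : MeasurableSet K := hKc.isClosed.measurableSet
  obtain ⟨G, F, hG, hF, hGF, hGg, hFf, hG1, hF1, -⟩ := h.exists_approx hΩ hKc hφ.2.2
  obtain ⟨C, hC0, hC⟩ := hφ.exists_bound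
  obtain ⟨C', hC'0, hC'⟩ := hφ.laplacian.exists_bound
  have hGi : ∀ n, IntegrableOn (G n) K := fun n => (hG n).continuous.continuousOn.integrableOn_compact hKc
  have hFi : ∀ n, IntegrableOn (F n) K := fun n => (hF n).continuous.continuousOn.integrableOn_compact hKc
  have t1 : Tendsto (fun n => ∫ x, _root_.smoothPos ε (G n x) * laplacian φ x) atTop
      (𝓝 (∫ x, _root_.smoothPos ε (g x) * laplacian φ x)) := by
    refine tendsto_integral_mul_of_tendsto_L1 (B := fun _ => laplacian φ) hKm
      (fun n => hspi (hGi n)) (hspi (h.1 K hφ.2.2 hKc))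
      (fun n => hφ.laplacian.continuous.aestronglyMeasurable) (fun n x => hC' x)
      (fun n x hx => laplacian_eq_zero_of_notMem_tsupport hx)
      (fun x hx => laplacian_eq_zero_of_notMem_tsupport hx) ?_
      (ae_of_all _ fun x _ => tendsto_const_nhds)
    refine squeeze_zero (fun n => integral_nonneg fun x => abs_nonneg _) (fun n => ?_) hG1
    refine integral_mono ((hspi (hGi n)).sub (hspi (h.1 K hφ.2.2 hKc))).abs
      ((hGi n).sub (h.1 K hφ.2.2 hKc)).abs fun x => ?_
    simpa [Real.dist_eq] using (lipschitzWith_smoothPos ε).dist_le_mul (G n x) (g x)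
  have t2 : Tendsto (fun n => ∫ x, F n x * (deriv (_root_.smoothPos ε) (G n x) * φ x)) atTop
      (𝓝 (∫ x, f x * (deriv (_root_.smoothPos ε) (g x) * φ x))) := by
    refine tendsto_integral_mul_of_tendsto_L1 (C := C) hKm hFi (h.2.1 K hφ.2.2 hKc)
      (fun n => ((hm'.continuous.comp (hG n).continuous).mul hφ.continuous).aestronglyMeasurable)
      (fun n x => ?_) (fun n x hx => by rw [image_eq_zero_of_notMem_tsupport hx, mul_zero])
      (fun x hx => by rw [image_eq_zero_of_notMem_tsupport hx, mul_zero]) hF1 ?_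
    · rw [abs_mul, abs_of_nonneg (deriv_smoothPos_nonneg ε _)]
      exact (mul_le_of_le_one_left (abs_nonneg _) (deriv_smoothPos_le_one ε _)).trans (hC x)
    · filter_upwards [hGg] with x hx hxK
      exact ((hm'.continuous.tendsto _).comp (hx hxK)).mul_const _
  have key := le_of_tendsto_of_tendsto' t1.neg t2 fun n => ?_
  · simp_rw [neg_mul, integral_neg]
    refine key.trans_eq (integral_congr_ae (ae_of_all _ fun x => ?_))
    simp only; ring
  · have hs : ContDiff ℝ (⊤ : ℕ∞) fun x => _root_.smoothPos ε (G n x) := hm.comp (hG n)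
    rw [integral_laplacian_mul hs hφ.1 hφ.2.1, ← integral_neg]
    refine integral_mono
      (integrable_mul_of_hasCompactSupport (contDiff_laplacian hs).continuous hφ.continuous
        hφ.2.1).neg
      (integrable_mul_of_hasCompactSupport (hF n).continuous
        ((hm'.continuous.comp (hG n).continuous).mul hφ.continuous) hφ.2.1.mul_left) fun x => ?_
    by_cases hx : x ∈ K
    · simp only
      rw [laplacian_comp hm (hG n)]
      have h1 := mul_le_mul_of_nonneg_left (hGF n x hx) (deriv_smoothPos_nonneg ε (G n x))
      have h2 : 0 ≤ deriv (deriv (_root_.smoothPos ε)) (G n x) * ∑ i, (pderiv i (G n) x) ^ 2 :=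
        mul_nonneg (deriv_deriv_smoothPos_nonneg hε _) (Finset.sum_nonneg fun i _ => sq_nonneg _)
      have h3 := hφ0 x
      nlinarith
    · simp [image_eq_zero_of_notMem_tsupport hx]

end NegLapLE

section WeakSol

variable {N : ℕ} {f g F w h p φ : Euc N → ℝ} {D Ω : Set (Euc N)} {lam : ℝ}

/-- The bilinear form associated with `lam - Δ`. -/
def energy (lam : ℝ) (f p : Euc N → ℝ) : ℝ := ∫ x, f x * (lam * p x - laplacian p x)

lemma IsTestFun.energy_integrable (hp : IsTestFun Ω p) (hf : Continuous f) (lam : ℝ) :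
    Integrable fun x => f x * (lam * p x - _root_.laplacian p x) :=
  (((integrable_mul_of_hasCompactSupport hf hp.continuous hp.2.1).const_mul lam).sub
    (integrable_mul_of_hasCompactSupport hf hp.laplacian.continuous hp.laplacian.2.1)).congr
    (ae_of_all _ fun x => by simp only [Pi.sub_apply]; ring)

lemma IsTestFun.integrable_grad (hp : IsTestFun Ω p) (hf : ContDiff ℝ (⊤ : ℕ∞) f) :
    Integrable fun x => lam * (f x * p x) + ∑ i, pderiv i f x * pderiv i p x :=
  ((integrable_mul_of_hasCompactSupport hf.continuous hp.continuous hp.2.1).const_mul lam).add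
    (integrable_finsetSum _ fun i _ => integrable_mul_of_hasCompactSupport
      (contDiff_pderiv hf i).continuous (contDiff_pderiv hp.1 i).continuous
      (hasCompactSupport_pderiv hp.2.1 i))

lemma energy_eq (hf : ContDiff ℝ (⊤ : ℕ∞) f) (hp : IsTestFun Ω p) :
    energy lam f p = ∫ x, (lam * (f x * p x) + ∑ i, pderiv i f x * pderiv i p x) := by
  have i1 := (integrable_mul_of_hasCompactSupport hf.continuous hp.continuous hp.2.1).const_mul lam
  have i2 := integrable_mul_of_hasCompactSupport hf.continuous hp.laplacian.continuous
    hp.laplacian.2.1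
  have i3 : Integrable fun x => ∑ i, pderiv i f x * pderiv i p x :=
    integrable_finsetSum _ fun i _ => integrable_mul_of_hasCompactSupport
      (contDiff_pderiv hf i).continuous (contDiff_pderiv hp.1 i).continuous
      (hasCompactSupport_pderiv hp.2.1 i)
  rw [integral_add i1 i3, ← neg_neg (∫ x, ∑ i, pderiv i f x * pderiv i p x),
    ← integral_mul_laplacian hf hp.1 hp.2.1, ← sub_eq_add_neg, ← integral_sub i1 i2]
  exact integral_congr_ae (ae_of_all _ fun x => by simp only; ring)

lemma energy_comm (hf : IsTestFun Ω f) (hp : IsTestFun Ω p) :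
    energy lam f p = energy lam p f := by
  rw [energy_eq hf.1 hp, energy_eq hp.1 hf]
  simp_rw [mul_comm]

lemma energy_add_mul (hf : Continuous f) (hg : Continuous g) (hp : IsTestFun Ω p) (t : ℝ) :
    energy lam (fun x => f x + t * g x) p = energy lam f p + t * energy lam g p := by
  unfold energy
  rw [← integral_const_mul, ← integral_add (hp.energy_integrable hf lam)
    ((hp.energy_integrable hg lam).const_mul t)]
  exact integral_congr_ae (ae_of_all _ fun x => by simp only; ring)

lemma energy_add_mul_self (hf : IsTestFun Ω f) (hp : IsTestFun Ω p) (t : ℝ) :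
    energy lam (fun x => f x + t * p x) (fun x => f x + t * p x) =
      energy lam f f + 2 * t * energy lam f p + t ^ 2 * energy lam p p := by
  have hfp := hf.add (hp.const_mul t)
  rw [energy_add_mul hf.continuous hp.continuous hfp, energy_comm hf hfp, energy_comm hp hfp,
    energy_add_mul hf.continuous hp.continuous hf, energy_add_mul hf.continuous hp.continuous hp,
    energy_comm hp hf]
  ring

lemma IsTestFun.integrable_sq (hp : IsTestFun Ω p) : Integrable fun x => p x ^ 2 := by
  simpa only [sq] using integrable_mul_of_hasCompactSupport hp.continuous hp.continuous hp.2.1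

lemma mul_integral_sq_le_energy (hp : IsTestFun Ω p) :
    lam * ∫ x, p x ^ 2 ≤ energy lam p p := by
  rw [energy_eq hp.1 hp, ← integral_const_mul]
  refine integral_mono (hp.integrable_sq.const_mul lam) (hp.integrable_grad hp.1) fun x => ?_
  have : 0 ≤ ∑ i, pderiv i p x * pderiv i p x := Finset.sum_nonneg fun i _ => mul_self_nonneg _
  simp only
  nlinarith

lemma energy_self_nonneg (hlam : 0 ≤ lam) (hp : IsTestFun Ω p) : 0 ≤ energy lam p p :=
  (mul_nonneg hlam (integral_nonneg fun _ => sq_nonneg _)).trans (mul_integral_sq_le_energy hp)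

lemma IsTestFun.integrable_bdd_mul {C : ℝ} (hp : IsTestFun Ω p) (hF : Measurable F)
    (hFC : ∀ x, |F x| ≤ C) : Integrable fun x => F x * p x :=
  hp.integrable.bdd_mul (c := C) hF.aestronglyMeasurable (ae_of_all _ hFC)

/-- `w` is the weak solution of `lam * w - Δ w = F` in `D` with zero boundary values, obtained as
the limit of test functions. -/
def IsWeakSol (D : Set (Euc N)) (lam : ℝ) (F w : Euc N → ℝ) : Prop :=
  Integrable w ∧ ∃ (φ : ℕ → Euc N → ℝ) (ε : ℕ → ℝ), (∀ j, IsTestFun D (φ j)) ∧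
    Tendsto ε atTop (𝓝 0) ∧
    (∀ j p, IsTestFun D p → |energy lam (φ j) p - ∫ x, F x * p x| ≤ ε j * √(energy lam p p)) ∧
    (∀ᵐ x, Tendsto (fun j => φ j x) atTop (𝓝 (w x))) ∧
    Tendsto (fun j => ∫ x, |φ j x - w x|) atTop (𝓝 0)

lemma IsWeakSol.congr {w' : Euc N → ℝ} (hw : IsWeakSol D lam F w) (h : w =ᵐ[volume] w') :
    IsWeakSol D lam F w' := by
  obtain ⟨hi, φ, ε, h1, h2, h3, h4, h5⟩ := hw
  refine ⟨hi.congr h, φ, ε, h1, h2, h3, ?_, ?_⟩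
  · filter_upwards [h4, h] with x hx hx'
    rwa [← hx']
  · refine h5.congr fun j => integral_congr_ae ?_
    filter_upwards [h] with x hx
    rw [hx]

lemma IsWeakSol.ae_eq_zero (hw : IsWeakSol D lam F w) : ∀ᵐ x, x ∉ D → w x = 0 := by
  obtain ⟨hi, φ, ε, h1, h2, h3, h4, h5⟩ := hw
  filter_upwards [h4] with x hx hxD
  refine tendsto_nhds_unique hx ?_
  simp_rw [fun j => (h1 j).eq_zero hxD]
  exact tendsto_const_nhds

lemma IsWeakSol.energy_eq (hw : IsWeakSol D lam F w) (hp : IsTestFun D p) :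
    energy lam w p = ∫ x, F x * p x := by
  obtain ⟨hi, φ, ε, h1, h2, h3, h4, h5⟩ := hw
  have t1 : Tendsto (fun j => energy lam (φ j) p) atTop (𝓝 (energy lam w p)) := by
    obtain ⟨C, -, hC⟩ := (IsTestFun.add (hp.const_mul lam) (hp.laplacian.const_mul (-1))).exists_bound
    refine tendsto_integral_mul_of_tendsto_L1 (K := univ) (C := C)
      (B := fun _ x => lam * p x - laplacian p x) MeasurableSet.univ
      (fun n => (h1 n).integrable.integrableOn) hi.integrableOn
      (fun n => ((hp.continuous.const_mul lam).sub hp.laplacian.continuous).aestronglyMeasurable)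
      (fun n x => ?_) (by simp) (by simp) ?_ (ae_of_all _ fun x _ => tendsto_const_nhds)
    · refine le_trans (le_of_eq ?_) (hC x)
      congr 1; ring
    · simpa using h5
  have t2 : Tendsto (fun j => energy lam (φ j) p - ∫ x, F x * p x) atTop (𝓝 0) :=
    squeeze_zero_norm (fun j => h3 j p hp) (by simpa using h2.mul_const _)
  have := tendsto_nhds_unique (t1.sub_const (∫ x, F x * p x)) t2
  linarith

lemma IsWeakSol.sub {F' w' : Euc N → ℝ} {C C' : ℝ} (hw : IsWeakSol D lam F w)
    (hw' : IsWeakSol D lam F' w') (hF : Measurable F) (hFC : ∀ x, |F x| ≤ C)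
    (hF' : Measurable F') (hFC' : ∀ x, |F' x| ≤ C') :
    IsWeakSol D lam (fun x => F x - F' x) (fun x => w x - w' x) := by
  obtain ⟨hi, φ, ε, h1, h2, h3, h4, h5⟩ := hw
  obtain ⟨hi', φ', ε', h1', h2', h3', h4', h5'⟩ := hw'
  have hfun : ∀ j, (fun x => φ j x - φ' j x) = fun x => φ j x + (-1) * φ' j x := fun j => by
    ext x; ring
  refine ⟨hi.sub hi', fun j x => φ j x - φ' j x, fun j => ε j + ε' j, fun j => ?_,
    by simpa using h2.add h2', fun j p hp => ?_, ?_, ?_⟩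
  · simp only [hfun]
    exact (h1 j).add ((h1' j).const_mul _)
  · have e1 : ∫ x, (F x - F' x) * p x = (∫ x, F x * p x) - ∫ x, F' x * p x := by
      rw [← integral_sub (hp.integrable_bdd_mul hF hFC) (hp.integrable_bdd_mul hF' hFC')]
      exact integral_congr_ae (ae_of_all _ fun x => by simp only; ring)
    simp only [hfun]
    rw [energy_add_mul (h1 j).continuous (h1' j).continuous hp, e1]
    have a1 := abs_le.1 (h3 j p hp)
    have a2 := abs_le.1 (h3' j p hp)
    rw [add_mul, abs_le]
    constructor <;> linarith [a1.1, a1.2, a2.1, a2.2]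
  · filter_upwards [h4, h4'] with x hx hx' using hx.sub hx'
  · refine squeeze_zero (fun j => integral_nonneg fun x => abs_nonneg _) (fun j => ?_)
      (by simpa using h5.add h5')
    have i1 := ((h1 j).integrable.sub hi).abs
    have i2 := ((h1' j).integrable.sub hi').abs
    have i3 := (((h1 j).integrable.sub (h1' j).integrable).sub (hi.sub hi')).abs
    simp only [Pi.sub_apply] at i1 i2 i3
    rw [← integral_add i1 i2]
    refine integral_mono i3 (i1.add i2) fun x => ?_
    have := abs_sub (φ j x - w x) (φ' j x - w' x)
    simp only
    refine le_trans (le_of_eq ?_) this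
    congr 1; ring

lemma exists_isWeakSol {C : ℝ} (hD : IsOpen D) (hDb : Bornology.IsBounded D) (hlam : 0 < lam)
    (hF : Measurable F) (hFC : ∀ x, |F x| ≤ C) : ∃ w, IsWeakSol D lam F w := by
  have hDm := hD.measurableSet
  have hDfin : volume D ≠ ⊤ := hDb.measure_lt_top.ne
  set V := volume.real D with hV
  have hV0 : 0 ≤ V := measureReal_nonneg
  set J : (Euc N → ℝ) → ℝ := fun p => energy lam p p / 2 - ∫ x, F x * p x with hJ
  have hJbd : ∀ p, IsTestFun D p → -(C ^ 2 / (2 * lam) * V) ≤ J p := by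
    intro p hp
    have h1 : ∫ x, F x * p x ≤ C ^ 2 / (2 * lam) * V + lam / 2 * ∫ x, p x ^ 2 := by
      have e : ∫ x in D, (C ^ 2 / (2 * lam) : ℝ) = C ^ 2 / (2 * lam) * V := by
        rw [setIntegral_const, smul_eq_mul, mul_comm]
      rw [← e, ← integral_indicator hDm, ← integral_const_mul, ← integral_add
        ((integrable_indicator_iff hDm).2 (integrableOn_const hDfin))
        (hp.integrable_sq.const_mul _)]
      refine integral_mono (hp.integrable_bdd_mul hF hFC)
        (((integrable_indicator_iff hDm).2 (integrableOn_const hDfin)).add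
        (hp.integrable_sq.const_mul _)) fun x => ?_
      by_cases hx : x ∈ D
      · simp only [indicator_of_mem hx]
        have h2 : F x ^ 2 ≤ C ^ 2 := sq_le_sq' (abs_le.1 (hFC x)).1 (abs_le.1 (hFC x)).2
        have h3 : C ^ 2 / (2 * lam) + lam / 2 * p x ^ 2 - F x * p x =
          ((C ^ 2 - F x ^ 2) + (F x - lam * p x) ^ 2) / (2 * lam) := by field_simp; ring
        have : 0 ≤ ((C ^ 2 - F x ^ 2) + (F x - lam * p x) ^ 2) / (2 * lam) := by
          apply div_nonneg _ (by positivity)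
          nlinarith [sq_nonneg (F x - lam * p x)]
        linarith
      · simp [indicator_of_notMem hx, hp.eq_zero hx]
    have h2 := mul_integral_sq_le_energy (lam := lam) hp
    simp only [hJ]
    linarith
  set S : Set ℝ := J '' {p | IsTestFun D p} with hS
  have hSne : S.Nonempty := by
    obtain ⟨φ, hφ, -⟩ := exists_isTestFun_eq_one hD isCompact_empty (empty_subset D)
    exact ⟨_, φ, hφ, rfl⟩
  have hSbd : BddBelow S := ⟨_, by rintro _ ⟨p, hp, rfl⟩; exact hJbd p hp⟩
  have hch : ∀ j : ℕ, ∃ p, IsTestFun D p ∧ J p < sInf S + ((1 / 2 : ℝ) ^ j) ^ 2 / 2 := by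
    intro j
    obtain ⟨_, ⟨p, hp, rfl⟩, h⟩ := exists_lt_of_csInf_lt hSne
      (lt_add_of_pos_right (sInf S) (by positivity : 0 < ((1 / 2 : ℝ) ^ j) ^ 2 / 2))
    exact ⟨p, hp, h⟩
  choose φ hφ hφJ using hch
  have hvar : ∀ j p, IsTestFun D p →
      |energy lam (φ j) p - ∫ x, F x * p x| ≤ (1 / 2 : ℝ) ^ j * √(energy lam p p) := by
    intro j p hp
    have hA := energy_self_nonneg hlam.le hp
    set A := energy lam p p
    set r := energy lam (φ j) p - ∫ x, F x * p x with hr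
    have h1 : ∀ t : ℝ, 0 ≤ A / 2 * (t * t) + r * t + ((1 / 2 : ℝ) ^ j) ^ 2 / 2 := by
      intro t
      have ht := (hφ j).add (hp.const_mul t)
      have h2 : sInf S ≤ J (fun x => φ j x + t * p x) := csInf_le hSbd ⟨_, ht, rfl⟩
      have h3 : ∫ x, F x * (φ j x + t * p x) = (∫ x, F x * φ j x) + t * ∫ x, F x * p x := by
        rw [← integral_const_mul, ← integral_add ((hφ j).integrable_bdd_mul hF hFC)
          ((hp.integrable_bdd_mul hF hFC).const_mul t)]
        exact integral_congr_ae (ae_of_all _ fun x => by simp only; ring)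
      have h4 := hφJ j
      simp only [hJ] at h2 h4
      rw [energy_add_mul_self (hφ j) hp, h3] at h2
      rw [hr]
      nlinarith
    have h5 := discrim_le_zero h1
    rw [discrim] at h5
    rw [← Real.sqrt_sq (by positivity : (0 : ℝ) ≤ (1 / 2) ^ j), ← Real.sqrt_mul (sq_nonneg _)]
    refine Real.abs_le_sqrt ?_
    nlinarith
  have hcau : ∀ i j, ∫ x, |φ i x - φ j x| ≤
      ((1 / 2 : ℝ) ^ i + (1 / 2 : ℝ) ^ j) * ((1 / lam + V) / 2) := by
    intro i j
    set η := (1 / 2 : ℝ) ^ i + (1 / 2 : ℝ) ^ j with hη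
    have hη0 : 0 < η := by positivity
    set ψ : Euc N → ℝ := fun x => φ i x + (-1) * φ j x with hψ
    have hψt : IsTestFun D ψ := (hφ i).add ((hφ j).const_mul _)
    have hA := energy_self_nonneg hlam.le hψt
    have h1 : energy lam ψ ψ ≤ η * √(energy lam ψ ψ) := by
      have h2 := energy_add_mul (lam := lam) (hφ i).continuous (hφ j).continuous hψt (-1)
      have a1 := abs_le.1 (hvar i ψ hψt)
      have a2 := abs_le.1 (hvar j ψ hψt)
      rw [← hψ] at h2
      rw [hη, add_mul]
      linarith [a1.1, a1.2, a2.1, a2.2]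
    have h2 : lam * ∫ x, ψ x ^ 2 ≤ η ^ 2 := by
      refine (mul_integral_sq_le_energy hψt).trans ?_
      have h3 := Real.sq_sqrt hA
      have h4 := Real.sqrt_nonneg (energy lam ψ ψ)
      nlinarith [sq_nonneg (√(energy lam ψ ψ) - η)]
    have h3 : ∫ x, |ψ x| ≤ η / 2 * V + 1 / (2 * η) * ∫ x, ψ x ^ 2 := by
      have e : ∫ x in D, (η / 2 : ℝ) = η / 2 * V := by
        rw [setIntegral_const, smul_eq_mul, mul_comm]
      have i1 : Integrable (D.indicator fun _ => η / 2) :=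
        (integrable_indicator_iff hDm).2 (integrableOn_const hDfin)
      rw [← e, ← integral_indicator hDm, ← integral_const_mul, ← integral_add i1
        (hψt.integrable_sq.const_mul _)]
      refine integral_mono hψt.integrable.abs (i1.add (hψt.integrable_sq.const_mul _)) fun x => ?_
      by_cases hx : x ∈ D
      · simp only [indicator_of_mem hx]
        have h3 : η / 2 + 1 / (2 * η) * ψ x ^ 2 - |ψ x| = (η - |ψ x|) ^ 2 / (2 * η) := by
          rw [← sq_abs (ψ x)]; field_simp; ring
        have : 0 ≤ (η - |ψ x|) ^ 2 / (2 * η) := by positivity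
        linarith
      · simp [indicator_of_notMem hx, hψt.eq_zero hx]
    have h4 : 1 / (2 * η) * ∫ x, ψ x ^ 2 ≤ η / (2 * lam) := by
      rw [one_div_mul_eq_div, div_le_div_iff₀ (by positivity) (by positivity)]
      nlinarith
    have e1 : ∫ x, |φ i x - φ j x| = ∫ x, |ψ x| :=
      integral_congr_ae (ae_of_all _ fun x => by simp only [hψ]; congr 1; ring)
    rw [e1]
    refine h3.trans ?_
    have e2 : η * ((1 / lam + V) / 2) = η / 2 * V + η / (2 * lam) := by field_simp; ring
    linarith
  have hmem : ∀ n, MemLp (φ n) 1 volume := fun n => memLp_one_iff_integrable.2 (hφ n).integrable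
  have hL1 : ∀ {a b : Euc N → ℝ}, Integrable a → Integrable b →
      eLpNorm (a - b) 1 volume = ENNReal.ofReal (∫ x, |a x - b x|) := by
    intro a b ha hb
    rw [eLpNorm_one_eq_lintegral_enorm, ← ofReal_integral_norm_eq_lintegral_enorm (ha.sub hb)]
    rfl
  set c := ((1 / lam + V) / 2) with hc
  have hc0 : 0 < c := by positivity
  set B : ℕ → ENNReal := fun n => ENNReal.ofReal ((1 / 2 : ℝ) ^ n * (4 * c)) with hB
  have hBsum : ∑' n, B n ≠ ⊤ := by
    rw [hB, ← ENNReal.ofReal_tsum_of_nonneg (fun n => by positivity)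
      (summable_geometric_two.mul_right _)]
    exact ENNReal.ofReal_ne_top
  have hBc : ∀ M n m, M ≤ n → M ≤ m → eLpNorm (φ n - φ m) 1 volume < B M := by
    intro M n m hn hm
    rw [hL1 (hφ n).integrable (hφ m).integrable, hB]
    rw [ENNReal.ofReal_lt_ofReal_iff (by positivity)]
    have h1 : (1 / 2 : ℝ) ^ n ≤ (1 / 2) ^ M := pow_le_pow_of_le_one (by norm_num) (by norm_num) hn
    have h2 : (1 / 2 : ℝ) ^ m ≤ (1 / 2) ^ M := pow_le_pow_of_le_one (by norm_num) (by norm_num) hm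
    have h3 : 0 < (1 / 2 : ℝ) ^ M := by positivity
    refine (hcau n m).trans_lt ?_
    nlinarith
  obtain ⟨w, hw, hwt⟩ := Lp.cauchy_complete_eLpNorm le_rfl hmem hBsum hBc
  have hwi := memLp_one_iff_integrable.1 hw
  have hae := Lp.ae_tendsto_of_cauchy_eLpNorm (fun n => (hmem n).aestronglyMeasurable) le_rfl hBsum hBc
  obtain ⟨ns, hns, hns'⟩ := (tendstoInMeasure_of_tendsto_eLpNorm one_ne_zero
    (fun n => (hmem n).aestronglyMeasurable) hw.aestronglyMeasurable hwt).exists_seq_tendsto_ae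
  refine ⟨w, hwi, φ, fun j => (1 / 2 : ℝ) ^ j, hφ,
    tendsto_pow_atTop_nhds_zero_of_lt_one (by norm_num) (by norm_num), hvar, ?_, ?_⟩
  · filter_upwards [hae, hns'] with x ⟨l, hl⟩ hx
    rwa [tendsto_nhds_unique hx (hl.comp hns.tendsto_atTop)]
  · have h1 := (ENNReal.tendsto_toReal ENNReal.zero_ne_top).comp hwt
    refine (h1.congr fun n => ?_)
    rw [Function.comp_apply, hL1 (hφ n).integrable hwi,
      ENNReal.toReal_ofReal (integral_nonneg fun x => abs_nonneg _)]

end WeakSol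

section Comparison

variable {N : ℕ} {f f' g g' F w h φ : Euc N → ℝ} {D Ω : Set (Euc N)} {lam : ℝ}

lemma IsTestFun.integrable_mul_of_locally (hφ : IsTestFun Ω φ)
    (hk : ∀ K ⊆ Ω, IsCompact K → IntegrableOn f K) : Integrable fun x => f x * φ x := by
  obtain ⟨C, -, hC⟩ := hφ.exists_bound
  have h1 : IntegrableOn (fun x => f x * φ x) (tsupport φ) :=
    (hk _ hφ.2.2 hφ.2.1).mul_bdd (c := C) hφ.continuous.aestronglyMeasurable (ae_of_all _ hC)
  refine (integrableOn_iff_integrable_of_support_subset ?_).1 h1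
  exact (Function.support_mul_subset_right _ _).trans (subset_tsupport _)

lemma NegLapLE.congr_left (hg : NegLapLE Ω g f) (h : ∀ᵐ x, x ∈ Ω → g x = g' x) :
    NegLapLE Ω g' f := by
  refine ⟨fun K hK hKc => (hg.1 K hK hKc).congr ?_, hg.2.1, fun φ hφ hφ0 => ?_⟩
  · rw [EventuallyEq, ae_restrict_iff' hKc.isClosed.measurableSet]
    filter_upwards [h] with x hx hxK using hx (hK hxK)
  · refine (le_of_eq (integral_congr_ae ?_)).trans (hg.2.2 φ hφ hφ0)
    filter_upwards [h] with x hx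
    by_cases hxΩ : x ∈ Ω
    · rw [hx hxΩ]
    · rw [hφ.laplacian.eq_zero hxΩ, mul_zero, mul_zero]

lemma NegLapLE.mono_right (hg : NegLapLE Ω g f)
    (hi : ∀ K ⊆ Ω, IsCompact K → IntegrableOn f' K) (h : ∀ᵐ x, x ∈ Ω → f x ≤ f' x) :
    NegLapLE Ω g f' := by
  refine ⟨hg.1, hi, fun φ hφ hφ0 => (hg.2.2 φ hφ hφ0).trans ?_⟩
  refine integral_mono_ae (hφ.integrable_mul_of_locally hg.2.1)
    (hφ.integrable_mul_of_locally hi) ?_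
  filter_upwards [h] with x hx
  by_cases hxΩ : x ∈ Ω
  · exact mul_le_mul_of_nonneg_right (hx hxΩ) (hφ0 x)
  · simp [hφ.eq_zero hxΩ]

lemma NegLapLE.mono_set (hg : NegLapLE Ω g f) (hD : D ⊆ Ω) : NegLapLE D g f :=
  ⟨fun K hK => hg.1 K (hK.trans hD), fun K hK => hg.2.1 K (hK.trans hD),
    fun φ hφ => hg.2.2 φ (hφ.mono hD)⟩

lemma IsTestFun.integral_laplacian (hp : IsTestFun Ω g) : ∫ x, _root_.laplacian g x = 0 := by
  have := integral_laplacian_mul (f := fun _ => (1 : ℝ)) contDiff_const hp.1 hp.2.1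
  simp only [one_mul] at this
  rw [this]
  have h0 : ∀ x : Euc N, _root_.laplacian (fun _ => (1 : ℝ)) x = 0 := fun x => by
    unfold _root_.laplacian
    exact Finset.sum_eq_zero fun i _ => by
      rw [iteratedFDeriv_const_of_ne (by norm_num)]; rfl
  simp [h0]

/-- The energy of the positive part of a smooth function. -/
lemma energy_smoothPos_le {p : Euc N → ℝ} (hlam : 0 ≤ lam) (hg : ContDiff ℝ (⊤ : ℕ∞) g)
    (hpg : p = fun x => smoothPos 1 (g x)) (hp : IsTestFun Ω p) :
    energy lam p p ≤ energy lam g p := by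
  rw [energy_eq hp.1 hp, energy_eq hg hp]
  refine integral_mono (hp.integrable_grad hp.1) (hp.integrable_grad hg) fun x => ?_
  have hm0 := smoothPos_nonneg one_pos (g x)
  have h1 : p x * p x ≤ g x * p x := by
    subst hpg
    rcases le_or_gt (g x) 0 with h | h
    · simp [smoothPos_of_nonpos one_pos h]
    · refine mul_le_mul_of_nonneg_right ?_ hm0
      simpa [h.le] using smoothPos_le_max one_pos (g x)
  have h2 : ∀ i, pderiv i p x * pderiv i p x ≤ pderiv i g x * pderiv i p x := fun i => by
    rw [hpg, pderiv_comp (contDiff_smoothPos 1) hg]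
    have h3 := deriv_smoothPos_nonneg 1 (g x)
    have h4 := deriv_smoothPos_le_one 1 (g x)
    have h5 : 0 ≤ deriv (smoothPos 1) (g x) * (1 - deriv (smoothPos 1) (g x)) *
      pderiv i g x ^ 2 := mul_nonneg (mul_nonneg h3 (sub_nonneg.2 h4)) (sq_nonneg _)
    simp only
    nlinarith
  exact add_le_add (mul_le_mul_of_nonneg_left h1 hlam) (Finset.sum_le_sum fun i _ => h2 i)

/-- Comparison of a weak solution with a supersolution defined on a larger set. -/
lemma IsWeakSol.le_of_neg_lap_le {C Ch : ℝ} (hw : IsWeakSol D lam F w) (hD : IsOpen D)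
    (hDc : IsCompact (closure D)) (hlam : 0 < lam) (hF : Measurable F) (hFC : ∀ x, |F x| ≤ C)
    (hΩ : IsOpen Ω) (hDΩ : closure D ⊆ Ω) (hh : NegLapLE Ω (fun x => -h x) f)
    (hh0 : ∀ x, 0 ≤ h x) (hhC : ∀ x, |h x| ≤ Ch) (hfC : ∀ x, |f x| ≤ C)
    (hfF : ∀ᵐ x, x ∈ D → f x ≤ lam * h x - F x) : ∀ᵐ x, x ∈ D → w x ≤ h x := by
  have hDm := hD.measurableSet
  have hDfin : volume D ≠ ⊤ := (measure_mono subset_closure).trans_lt hDc.measure_lt_top |>.ne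
  obtain ⟨G, f', hG, hf', hGf, hGt, hft, -, -, hGC, hfC', hG0⟩ := hh.exists_approx hΩ hDc hDΩ
  replace hG0 := hG0 fun x => neg_nonpos.2 (hh0 x)
  replace hGC := hGC Ch fun x => by rw [abs_neg]; exact hhC x
  replace hfC' := hfC' C hfC
  obtain ⟨hi, φ, ε, hφ, hε, hφF, hφw, -⟩ := hw
  set p : ℕ → Euc N → ℝ := fun j x => smoothPos 1 (φ j x + G j x) with hp
  have hpt : ∀ j, IsTestFun D (p j) := fun j => by
    have hs : tsupport (p j) ⊆ tsupport (φ j) := by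
      refine closure_mono fun x hx => ?_
      by_contra h0
      rw [Function.mem_support, not_not] at h0
      exact hx (smoothPos_of_nonpos one_pos (by rw [h0, zero_add]; exact hG0 j x))
    exact ⟨(contDiff_smoothPos 1).comp ((hφ j).1.add (hG j)),
      (hφ j).2.1.of_isClosed_subset (isClosed_tsupport _) hs, hs.trans (hφ j).2.2⟩
  have hp0 : ∀ j x, 0 ≤ p j x := fun j x => smoothPos_nonneg one_pos _
  set e : ℕ → Euc N → ℝ := fun j x => max (F x + lam * G j x + f' j x) 0 with he
  have hem : ∀ j, Measurable (e j) := fun j =>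
    ((hF.add ((hG j).continuous.measurable.const_mul lam)).add
      (hf' j).continuous.measurable).max measurable_const
  have heC : ∀ j x, |e j x| ≤ C + lam * Ch + C := fun j x => by
    have h1 := abs_le.1 (hFC x)
    have h2 := abs_le.1 (hGC j x)
    have h3 := abs_le.1 (hfC' j x)
    have h4 : lam * G j x ≤ lam * Ch := mul_le_mul_of_nonneg_left h2.2 hlam.le
    have h5 : 0 ≤ lam * Ch := mul_nonneg hlam.le ((abs_nonneg _).trans (hGC j x))
    rw [abs_of_nonneg (le_max_right _ _)]
    exact max_le (by linarith) (by linarith)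
  have heE : Tendsto (fun j => ∫ x in D, e j x ^ 2) atTop (𝓝 0) := by
    rw [← integral_zero (Euc N) ℝ (μ := volume.restrict D)]
    refine tendsto_integral_of_dominated_convergence (fun _ => (C + lam * Ch + C) ^ 2)
      (fun j => ((hem j).pow_const 2).aestronglyMeasurable) (integrableOn_const hDfin)
      (fun j => ae_of_all _ fun x => ?_) ?_
    · rw [Real.norm_of_nonneg (sq_nonneg _), ← sq_abs]
      exact pow_le_pow_left₀ (abs_nonneg _) (heC j x) 2
    · rw [ae_restrict_iff' hDm]
      filter_upwards [hGt, hft, hfF] with x h1 h2 h3 hxD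
      have t := (((h1 (subset_closure hxD)).const_mul lam).const_add (F x)).add
        (h2 (subset_closure hxD))
      have t2 := (t.max (tendsto_const_nhds (x := (0 : ℝ)))).pow 2
      have h4 : max (F x + lam * -h x + f x) 0 = 0 := max_eq_right (by linarith [h3 hxD])
      rw [h4] at t2
      simpa using t2
  have hei : ∀ j, IntegrableOn (fun x => e j x ^ 2) D := fun j => by
    refine Integrable.mono' (integrableOn_const hDfin (C := (C + lam * Ch + C) ^ 2))
      ((hem j).pow_const 2).aestronglyMeasurable (ae_of_all _ fun x => ?_)
    rw [Real.norm_of_nonneg (sq_nonneg _), ← sq_abs]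
    exact pow_le_pow_left₀ (abs_nonneg _) (heC j x) 2
  have key : ∀ j, lam * ∫ x, p j x ^ 2 ≤ 4 * ε j ^ 2 + 2 / lam * ∫ x in D, e j x ^ 2 := by
    intro j
    have hgs : ContDiff ℝ (⊤ : ℕ∞) fun x => φ j x + 1 * G j x :=
      (hφ j).1.add (contDiff_const.mul (hG j))
    have h1 : energy lam (p j) (p j) ≤ energy lam (fun x => φ j x + 1 * G j x) (p j) :=
      energy_smoothPos_le hlam.le hgs (by simp [hp]) (hpt j)
    rw [energy_add_mul (hφ j).continuous (hG j).continuous (hpt j), one_mul] at h1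
    have h2 := (abs_le.1 (hφF j (p j) (hpt j))).2
    have h3 : (∫ x, F x * p j x) + energy lam (G j) (p j) ≤
        1 / (2 * lam) * (∫ x in D, e j x ^ 2) + lam / 2 * ∫ x, p j x ^ 2 := by
      have i1 := (hpt j).integrable_bdd_mul hF hFC
      have i2 := (integrable_mul_of_hasCompactSupport (hG j).continuous (hpt j).continuous
        (hpt j).2.1).const_mul lam
      have i3 := integrable_mul_of_hasCompactSupport (contDiff_laplacian (hG j)).continuous
        (hpt j).continuous (hpt j).2.1
      have i4 := integrable_mul_of_hasCompactSupport (hG j).continuous (hpt j).laplacian.continuous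
        (hpt j).laplacian.2.1
      have e1 : energy lam (G j) (p j) =
          (∫ x, lam * (G j x * p j x)) - ∫ x, laplacian (G j) x * p j x := by
        rw [← integral_laplacian_mul (hG j) (hpt j).1 (hpt j).2.1, ← integral_sub i2 i4]
        exact integral_congr_ae (ae_of_all _ fun x => by simp only; ring)
      have i5 : Integrable (D.indicator fun x => e j x ^ 2) := (integrable_indicator_iff hDm).2 (hei j)
      rw [e1, ← integral_sub i2 i3,
        ← integral_add (g := fun x => lam * (G j x * p j x) - laplacian (G j) x * p j x) i1
          (i2.sub i3), ← integral_indicator hDm,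
        ← integral_const_mul, ← integral_const_mul,
        ← integral_add (i5.const_mul _) ((hpt j).integrable_sq.const_mul _)]
      refine integral_mono (i1.add (i2.sub i3))
        ((i5.const_mul _).add ((hpt j).integrable_sq.const_mul _)) fun x => ?_
      by_cases hx : x ∈ D
      · simp only [indicator_of_mem hx]
        have h4 := hGf j x (subset_closure hx)
        have h5 : F x + lam * G j x + f' j x ≤ e j x := le_max_left _ _
        have h6 := mul_le_mul_of_nonneg_right
          (show F x + lam * G j x - laplacian (G j) x ≤ e j x by linarith) (hp0 j x)
        have h7 : 1 / (2 * lam) * e j x ^ 2 + lam / 2 * p j x ^ 2 - e j x * p j x =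
          (e j x - lam * p j x) ^ 2 / (2 * lam) := by field_simp; ring
        have h8 : 0 ≤ (e j x - lam * p j x) ^ 2 / (2 * lam) := by positivity
        nlinarith
      · simp [indicator_of_notMem hx, (hpt j).eq_zero hx]
    have h4 := energy_self_nonneg hlam.le (hpt j)
    have h5 := mul_integral_sq_le_energy (lam := lam) (hpt j)
    have h6 := Real.sq_sqrt h4
    have h7 : 2 / lam * (∫ x in D, e j x ^ 2) = 4 * (1 / (2 * lam) * ∫ x in D, e j x ^ 2) := by
      field_simp; ring
    rw [h7]
    nlinarith [sq_nonneg (2 * ε j - √(energy lam (p j) (p j)))]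
  have hlim : Tendsto (fun j => ∫ x, p j x ^ 2) atTop (𝓝 0) := by
    have t : Tendsto (fun j => lam⁻¹ * (4 * ε j ^ 2 + 2 / lam * ∫ x in D, e j x ^ 2)) atTop
        (𝓝 0) := by
      simpa using (((hε.pow 2).const_mul 4).add (heE.const_mul (2 / lam))).const_mul lam⁻¹
    refine squeeze_zero (fun j => integral_nonneg fun x => sq_nonneg _) (fun j => ?_) t
    rw [← div_eq_inv_mul, le_div_iff₀' hlam]
    exact key j
  have hfat : ∫⁻ x in D, ENNReal.ofReal (smoothPos 1 (w x - h x) ^ 2) ≤ 0 := by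
    have h1 : ∀ᵐ x ∂(volume.restrict D), ENNReal.ofReal (smoothPos 1 (w x - h x) ^ 2) =
        liminf (fun j => ENNReal.ofReal (p j x ^ 2)) atTop := by
      rw [ae_restrict_iff' hDm]
      filter_upwards [hφw, hGt] with x h1 h2 hxD
      have t := ((((continuous_smoothPos 1).tendsto _).comp
        (h1.add (h2 (subset_closure hxD)))).pow 2)
      rw [← sub_eq_add_neg] at t
      exact ((ENNReal.tendsto_ofReal t).liminf_eq).symm
    rw [lintegral_congr_ae h1]
    refine (lintegral_liminf_le' fun j =>
      (((hpt j).continuous.measurable.pow_const 2).ennreal_ofReal).aemeasurable).trans ?_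
    have h2 : Tendsto (fun j => ENNReal.ofReal (∫ x, p j x ^ 2)) atTop (𝓝 0) := by
      simpa using ENNReal.tendsto_ofReal hlim
    rw [← h2.liminf_eq]
    refine liminf_le_liminf (Eventually.of_forall fun j => ?_)
    rw [ofReal_integral_eq_lintegral_ofReal (hpt j).integrable_sq (ae_of_all _ fun x => sq_nonneg _)]
    exact setLIntegral_le_lintegral _ _
  have hhm : AEMeasurable h (volume.restrict D) := by
    have h1 := (hh.1 _ hDΩ hDc).aestronglyMeasurable.aemeasurable.neg
    simp only [Pi.neg_def, neg_neg] at h1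
    exact h1.mono_measure (Measure.restrict_mono subset_closure le_rfl)
  have hmeas : AEMeasurable (fun x => ENNReal.ofReal (smoothPos 1 (w x - h x) ^ 2))
      (volume.restrict D) :=
    (((continuous_smoothPos 1).measurable.comp_aemeasurable
      (hi.aestronglyMeasurable.aemeasurable.restrict.sub hhm)).pow_const 2).ennreal_ofReal
  have h0 := (lintegral_eq_zero_iff' hmeas).1 (le_antisymm hfat bot_le)
  rw [EventuallyEq, ae_restrict_iff' hDm] at h0
  filter_upwards [h0] with x hx hxD
  by_contra hlt
  have h3 := smoothPos_pos (ε := 1) one_pos (sub_pos.2 (not_le.1 hlt))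
  have h4 := hx hxD
  rw [Pi.zero_apply, ENNReal.ofReal_eq_zero] at h4
  nlinarith [sq_nonneg (smoothPos 1 (w x - h x))]

end Comparison

section Semilinear

variable {N : ℕ} {F w : Euc N → ℝ} {D Ω : Set (Euc N)} {lam : ℝ}

lemma negLapLE_const (Ω : Set (Euc N)) (c : ℝ) : NegLapLE Ω (fun _ => c) (fun _ => 0) := by
  refine ⟨fun K _ hK => integrableOn_const hK.measure_lt_top.ne,
    fun K _ _ => integrableOn_zero, fun φ hφ _ => le_of_eq ?_⟩
  rw [integral_const_mul, hφ.integral_laplacian]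
  simp

lemma isWeakSol_zero (D : Set (Euc N)) (lam : ℝ) :
    IsWeakSol D lam (fun _ => 0) (fun _ => 0) := by
  refine ⟨integrable_zero _ _ _, fun _ _ => 0, fun _ => 0, fun _ => ⟨contDiff_const,
    HasCompactSupport.zero, ?_⟩, tendsto_const_nhds, fun j p _ => ?_,
    ae_of_all _ fun x => tendsto_const_nhds, by simp⟩
  · rw [tsupport, Function.support_fun_zero, closure_empty]
    exact empty_subset _
  · simp [energy]

lemma IsWeakSol.mono {F' w' : Euc N → ℝ} {C : ℝ} (hw : IsWeakSol D lam F w)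
    (hw' : IsWeakSol D lam F' w') (hD : IsOpen D) (hDb : Bornology.IsBounded D) (hlam : 0 < lam)
    (hF : Measurable F) (hFC : ∀ x, |F x| ≤ C) (hF' : Measurable F') (hFC' : ∀ x, |F' x| ≤ C)
    (h : ∀ᵐ x, x ∈ D → F x ≤ F' x) : ∀ᵐ x, w x ≤ w' x := by
  have hs := hw.sub hw' hF hFC hF' hFC'
  have h1 := hs.le_of_neg_lap_le (h := fun _ => 0) (f := fun _ => 0) (Ω := univ) (C := C + C)
    (Ch := 0) hD hDb.isCompact_closure hlam (hF.sub hF')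
    (fun x => (abs_sub _ _).trans (add_le_add (hFC x) (hFC' x))) isOpen_univ (subset_univ _)
    (by simpa using negLapLE_const univ 0) (by simp) (by simp)
    (fun x => by
      have := (abs_nonneg _).trans (hFC x)
      rw [abs_zero]; linarith)
    (by filter_upwards [h] with x hx hxD; simpa using hx hxD)
  filter_upwards [h1, hs.ae_eq_zero] with x h2 h3
  by_cases hx : x ∈ D
  · exact sub_nonpos.1 (h2 hx)
  · exact (sub_eq_zero.1 (h3 hx)).le

/-- Solvability of `-Δ w + G(x, w) = 0` in `D` with zero boundary values, and comparison of the
solution with supersolutions on larger sets. -/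
lemma exists_semilinear {G : Euc N → ℝ → ℝ} {M L B : ℝ} (hD : IsOpen D)
    (hDb : Bornology.IsBounded D) (hlam : 0 < lam) (hM0 : 0 ≤ M) (hML : M ≤ L)
    (hGm : Measurable (Function.uncurry G)) (hGB : ∀ x t, 0 ≤ t → t ≤ L → |G x t| ≤ B)
    (hGmono : ∀ x s t, 0 ≤ s → s ≤ t → t ≤ L → G x s ≤ G x t ∧ G x t - G x s ≤ lam * (t - s))
    (hG0 : ∀ x, G x 0 ≤ 0) (hGM : ∀ x, 0 ≤ G x M) :
    ∃ w : Euc N → ℝ, Measurable w ∧ (∀ x, 0 ≤ w x) ∧ (∀ x, w x ≤ M) ∧ (∀ x ∉ D, w x = 0) ∧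
      (∀ p, IsTestFun D p → ∫ x, (-(w x) * laplacian p x + G x (w x) * p x) = 0) ∧
      ∀ (Ω : Set (Euc N)) (h : Euc N → ℝ), IsOpen Ω → closure D ⊆ Ω →
        (∀ x, 0 ≤ h x) → (∀ x, h x ≤ L) →
        NegLapLE Ω (fun x => -h x) (fun x => G x (h x)) → ∀ᵐ x, w x ≤ h x := by
  have hDm := hD.measurableSet
  have hL0 := hM0.trans hML
  set T : (Euc N → ℝ) → Euc N → ℝ := fun w => D.indicator fun x => lam * w x - G x (w x) with hT
  have hGw : ∀ {w : Euc N → ℝ}, Measurable w → Measurable fun x => G x (w x) := fun {w} hw =>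
    hGm.comp (measurable_id.prodMk hw)
  have hTm : ∀ {w : Euc N → ℝ}, Measurable w → Measurable (T w) := fun {w} hw =>
    ((hw.const_mul lam).sub (hGw hw)).indicator hDm
  set C := lam * L + B with hC
  have hB0 : 0 ≤ B := (abs_nonneg _).trans (hGB 0 0 le_rfl hL0)
  have hlL : 0 ≤ lam * L := mul_nonneg hlam.le hL0
  have hTC : ∀ {w : Euc N → ℝ}, (∀ x, 0 ≤ w x) → (∀ x, w x ≤ L) → ∀ x, |T w x| ≤ C := by
    intro w h0 hL x
    by_cases hx : x ∈ D
    · simp only [hT, indicator_of_mem hx]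
      refine (abs_sub _ _).trans (add_le_add ?_ (hGB x _ (h0 x) (hL x)))
      rw [abs_of_nonneg (mul_nonneg hlam.le (h0 x))]
      exact mul_le_mul_of_nonneg_left (hL x) hlam.le
    · simp only [hT, indicator_of_notMem hx, abs_zero]
      linarith
  have hstep : ∀ w : Euc N → ℝ, Measurable w → (∀ x, 0 ≤ w x) → (∀ x, w x ≤ M) →
      ∃ w' : Euc N → ℝ, (Measurable w' ∧ (∀ x, 0 ≤ w' x) ∧ (∀ x, w' x ≤ M) ∧
        (∀ x ∉ D, w' x = 0)) ∧ IsWeakSol D lam (T w) w' := by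
    intro w hw h0 hM
    have hTwC := hTC h0 fun x => (hM x).trans hML
    obtain ⟨v, hv⟩ := exists_isWeakSol hD hDb hlam (hTm hw) hTwC
    have hv0 := (isWeakSol_zero D lam).mono hv hD hDb hlam measurable_const
      (C := C) (fun x => by rw [abs_zero]; linarith) (hTm hw) hTwC (ae_of_all _ fun x hx => by
        simp only [hT, indicator_of_mem hx]
        have h1 := (hGmono x 0 (w x) le_rfl (h0 x) ((hM x).trans hML)).2
        linarith [hG0 x])
    have hvM := hv.le_of_neg_lap_le (h := fun _ => M) (f := fun _ => 0) (Ω := univ) (C := C)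
      (Ch := M) hD hDb.isCompact_closure hlam (hTm hw) hTwC isOpen_univ (subset_univ _)
      (negLapLE_const univ (-M)) (fun _ => hM0) (fun _ => (abs_of_nonneg hM0).le)
      (fun x => by rw [abs_zero]; linarith) (ae_of_all _ fun x hx => by
        simp only [hT, indicator_of_mem hx]
        have h1 := (hGmono x (w x) M (h0 x) (hM x) hML).2
        linarith [hGM x])
    have hvm := hv.1.aestronglyMeasurable
    refine ⟨D.indicator fun x => max 0 (min (hvm.mk v x) M),
      ⟨(measurable_const.max
        (hvm.stronglyMeasurable_mk.measurable.min measurable_const)).indicator hDm,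
      fun x => indicator_nonneg (fun x _ => le_max_left _ _) x, fun x =>
        indicator_apply_le' (fun _ => max_le hM0 (min_le_right _ _)) fun _ => hM0,
      fun x hx => indicator_of_notMem hx _⟩, hv.congr ?_⟩
    filter_upwards [hv0, hvM, hv.ae_eq_zero, hvm.ae_eq_mk] with x h1 h2 h3 h4
    by_cases hx : x ∈ D
    · rw [indicator_of_mem hx, ← h4, min_eq_left (h2 hx), max_eq_right h1]
    · rw [indicator_of_notMem hx, h3 hx]
  let S := {w : Euc N → ℝ // Measurable w ∧ (∀ x, 0 ≤ w x) ∧ (∀ x, w x ≤ M) ∧ ∀ x ∉ D, w x = 0}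
  have hstep' : ∀ s : S, ∃ s' : S, IsWeakSol D lam (T s.1) s'.1 := fun s => by
    obtain ⟨w', h1, h2⟩ := hstep s.1 s.2.1 s.2.2.1 s.2.2.2.1
    exact ⟨⟨w', h1⟩, h2⟩
  choose R hR using hstep'
  let s₀ : S := ⟨fun _ => 0, measurable_const, fun _ => le_rfl, fun _ => hM0, fun _ _ => rfl⟩
  let W : ℕ → S := fun n => R^[n] s₀
  have hW : ∀ n, IsWeakSol D lam (T (W n).1) (W (n + 1)).1 := fun n => by
    simp only [W, Function.iterate_succ_apply']
    exact hR _
  have hWL : ∀ n x, (W n).1 x ≤ L := fun n x => ((W n).2.2.2.1 x).trans hML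
  have hTW : ∀ n x, |T (W n).1 x| ≤ C := fun n => hTC (W n).2.2.1 (hWL n)
  have hmono : ∀ n, ∀ᵐ x, (W n).1 x ≤ (W (n + 1)).1 x := by
    intro n
    induction n with
    | zero => exact ae_of_all _ fun x => (W 1).2.2.1 x
    | succ n ih =>
      refine (hW n).mono (hW (n + 1)) hD hDb hlam (hTm (W n).2.1) (hTW n) (hTm (W (n + 1)).2.1)
        (hTW (n + 1)) ?_
      filter_upwards [ih] with x hx hxD
      simp only [hT, indicator_of_mem hxD]
      linarith [(hGmono x _ _ ((W n).2.2.1 x) hx (hWL (n + 1) x)).2]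
  have hbdd : ∀ x, BddAbove (range fun n => (W n).1 x) := fun x =>
    ⟨M, by rintro _ ⟨n, rfl⟩; exact (W n).2.2.2.1 x⟩
  set w : Euc N → ℝ := fun x => ⨆ n, (W n).1 x with hw
  have hwm : Measurable w := Measurable.iSup fun n => (W n).2.1
  have hw0 : ∀ x, 0 ≤ w x := fun x => ((W 0).2.2.1 x).trans (le_ciSup (hbdd x) 0)
  have hwM : ∀ x, w x ≤ M := fun x => ciSup_le fun n => (W n).2.2.2.1 x
  have hwt : ∀ᵐ x, Tendsto (fun n => (W n).1 x) atTop (𝓝 (w x)) := by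
    filter_upwards [ae_all_iff.2 hmono] with x hx
    exact tendsto_atTop_ciSup (monotone_nat_of_le_succ hx) (hbdd x)
  refine ⟨w, hwm, hw0, hwM, fun x hx => ?_, fun p hp => ?_, fun Ω h hΩ hDΩ h0 hL hneg => ?_⟩
  · simp only [hw, fun n => (W n).2.2.2.2 x hx, ciSup_const]
  · have hGc : ∀ x, Tendsto (fun n => (W n).1 x) atTop (𝓝 (w x)) →
        Tendsto (fun n => G x ((W n).1 x)) atTop (𝓝 (G x (w x))) := by
      intro x hx
      rw [tendsto_iff_norm_sub_tendsto_zero]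
      have t : Tendsto (fun n => lam * (w x - (W n).1 x)) atTop (𝓝 0) := by
        simpa using (hx.const_sub (w x)).const_mul lam
      refine squeeze_zero (fun n => norm_nonneg _) (fun n => ?_) t
      have h1 := hGmono x _ _ ((W n).2.2.1 x) (le_ciSup (hbdd x) n) ((hwM x).trans hML)
      rw [Real.norm_eq_abs, abs_sub_comm, abs_of_nonneg (sub_nonneg.2 h1.1)]
      exact h1.2
    have t1 : Tendsto (fun n => energy lam (W (n + 1)).1 p) atTop (𝓝 (energy lam w p)) := by
      have hq := (hp.const_mul lam).add (hp.laplacian.const_mul (-1))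
      refine tendsto_integral_of_dominated_convergence
        (fun x => M * |lam * p x + -1 * laplacian p x|)
        (fun n => ((W (n + 1)).2.1.mul ((hp.continuous.measurable.const_mul lam).sub
          hp.laplacian.continuous.measurable)).aestronglyMeasurable)
        (hq.integrable.abs.const_mul M) (fun n => ae_of_all _ fun x => ?_) ?_
      · rw [norm_mul, Real.norm_of_nonneg ((W (n + 1)).2.2.1 x), Real.norm_eq_abs]
        have e : lam * p x - laplacian p x = lam * p x + -1 * laplacian p x := by ring
        rw [e]
        exact mul_le_mul_of_nonneg_right ((W (n + 1)).2.2.2.1 x) (abs_nonneg _)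
      · filter_upwards [hwt] with x hx
        exact ((tendsto_add_atTop_iff_nat 1).2 hx).mul_const _
    have t2 : Tendsto (fun n => ∫ x, T (W n).1 x * p x) atTop (𝓝 (∫ x, T w x * p x)) := by
      refine tendsto_integral_of_dominated_convergence (fun x => C * |p x|)
        (fun n => ((hTm (W n).2.1).mul hp.continuous.measurable).aestronglyMeasurable)
        (hp.integrable.abs.const_mul C) (fun n => ae_of_all _ fun x => ?_) ?_
      · rw [norm_mul]
        exact mul_le_mul_of_nonneg_right (hTW n x) (abs_nonneg _)
      · filter_upwards [hwt] with x hx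
        refine Tendsto.mul_const _ ?_
        by_cases hxD : x ∈ D
        · simp only [hT, indicator_of_mem hxD]
          exact (hx.const_mul lam).sub (hGc x hx)
        · simp only [hT, indicator_of_notMem hxD]
          exact tendsto_const_nhds
    have e1 := tendsto_nhds_unique t1 (t2.congr fun n => ((hW n).energy_eq hp).symm)
    have i1 : Integrable fun x => w x * (lam * p x - laplacian p x) := by
      refine (((hp.const_mul lam).add (hp.laplacian.const_mul (-1))).integrable_bdd_mul
        (C := M) hwm fun x => ?_).congr (ae_of_all _ fun x => by simp only; ring)
      rw [abs_of_nonneg (hw0 x)]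
      exact hwM x
    have i2 := hp.integrable_bdd_mul (hTm hwm) (hTC hw0 fun x => (hwM x).trans hML)
    have e2 := sub_eq_zero.2 e1
    rw [energy, ← integral_sub i1 i2] at e2
    rw [← e2]
    refine integral_congr_ae (ae_of_all _ fun x => ?_)
    by_cases hxD : x ∈ D
    · simp only [hT, indicator_of_mem hxD]; ring
    · simp only [hp.eq_zero hxD, hp.laplacian.eq_zero hxD]; ring
  · have hle : ∀ n, ∀ᵐ x, (W n).1 x ≤ h x := by
      intro n
      induction n with
      | zero => exact ae_of_all _ h0
      | succ n ih =>
        have h1 := (hW n).le_of_neg_lap_le (C := C) (Ch := L) hD hDb.isCompact_closure hlam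
          (hTm (W n).2.1) (hTW n) hΩ hDΩ hneg h0 (fun x => by rw [abs_of_nonneg (h0 x)]; exact hL x)
          (fun x => (hGB x _ (h0 x) (hL x)).trans (by linarith)) (by
            filter_upwards [ih] with x hx hxD
            simp only [hT, indicator_of_mem hxD]
            linarith [(hGmono x _ _ ((W n).2.2.1 x) hx (hL x)).2])
        filter_upwards [h1] with x hx
        by_cases hxD : x ∈ D
        · exact hx hxD
        · rw [(W (n + 1)).2.2.2.2 x hxD]; exact h0 x
    filter_upwards [ae_all_iff.2 hle] with x hx using ciSup_le hx

end Semilinear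

section Penalized

variable {N : ℕ} {f f' g g' u w φ : Euc N → ℝ} {D Ω : Set (Euc N)} {q : ℝ}

lemma NegLapLE.add (hg : NegLapLE Ω g f) (hg' : NegLapLE Ω g' f') :
    NegLapLE Ω (fun x => g x + g' x) (fun x => f x + f' x) := by
  refine ⟨fun K hK hKc => (hg.1 K hK hKc).add (hg'.1 K hK hKc),
    fun K hK hKc => (hg.2.1 K hK hKc).add (hg'.2.1 K hK hKc), fun φ hφ hφ0 => ?_⟩
  have h1 := add_le_add (hg.2.2 φ hφ hφ0) (hg'.2.2 φ hφ hφ0)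
  simp only [neg_mul, integral_neg] at h1 ⊢
  simp only [add_mul]
  rw [integral_add (hφ.laplacian.integrable_mul_of_locally hg.1)
    (hφ.laplacian.integrable_mul_of_locally hg'.1),
    integral_add (hφ.integrable_mul_of_locally hg.2.1) (hφ.integrable_mul_of_locally hg'.2.1)]
  linarith

lemma setIntegral_weak (hw : ∀ K ⊆ Ω, IsCompact K → IntegrableOn w K)
    (hg : ∀ K ⊆ Ω, IsCompact K → IntegrableOn g K) (hφ : IsTestFun Ω φ) :
    ∫ x in Ω, (-(w x) * laplacian φ x + g x * φ x) =
      (∫ x, g x * φ x) - ∫ x, w x * laplacian φ x := by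
  rw [setIntegral_eq_integral_of_forall_compl_eq_zero fun x hx => by
    rw [hφ.eq_zero hx, hφ.laplacian.eq_zero hx]; ring,
    ← integral_sub (hφ.integrable_mul_of_locally hg) (hφ.laplacian.integrable_mul_of_locally hw)]
  exact integral_congr_ae (ae_of_all _ fun x => by simp only; ring)

lemma negLapLE_of_integral_eq (hw : ∀ K ⊆ Ω, IsCompact K → IntegrableOn w K)
    (hg : ∀ K ⊆ Ω, IsCompact K → IntegrableOn g K)
    (h : ∀ φ, IsTestFun Ω φ → ∫ x, g x * φ x = ∫ x, w x * laplacian φ x) :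
    NegLapLE Ω (fun x => -(w x)) g := by
  refine ⟨fun K hK hKc => (hw K hK hKc).neg, hg, fun φ hφ _ => ?_⟩
  simp only [neg_neg]
  exact (h φ hφ).ge

lemma rpow_sub_rpow_le (hq : 1 ≤ q) {s t : ℝ} (hs : 0 ≤ s) (hst : s ≤ t) :
    t ^ q - s ^ q ≤ q * t ^ (q - 1) * (t - s) := by
  rcases (hs.trans hst).eq_or_lt with h | h
  · have : s = 0 := le_antisymm (hst.trans h.ge) hs
    subst h; subst this; simp
  · have h1 := one_add_mul_self_le_rpow_one_add (s := s / t - 1) (p := q)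
      (by have := div_nonneg hs h.le; linarith) hq
    rw [add_sub_cancel, Real.div_rpow hs h.le, le_div_iff₀ (Real.rpow_pos_of_pos h q)] at h1
    have h2 : t ^ q = t ^ (q - 1) * t := by
      rw [← Real.rpow_add_one h.ne']; congr 1; ring
    have h3 : (1 + q * (s / t - 1)) * t ^ q = t ^ q - q * t ^ (q - 1) * (t - s) := by
      rw [h2]; field_simp; ring
    linarith

/-- The penalized problem `-Δ w + w ^ q = k (u - w)₊`. -/
lemma exists_penalized (hq : 1 < q) {k M L : ℝ} (hD : IsOpen D) (hDb : Bornology.IsBounded D)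
    (hk : 0 ≤ k) (hM0 : 0 ≤ M) (hML : M ≤ L) (hum : Measurable u)
    (huM : ∀ᵐ x, x ∈ D → u x ≤ M) :
    ∃ w : Euc N → ℝ, Measurable w ∧ (∀ x, 0 ≤ w x) ∧ (∀ x, w x ≤ M) ∧ (∀ x ∉ D, w x = 0) ∧
      (∀ p, IsTestFun D p →
        ∫ x, (w x ^ q - k * max (u x - w x) 0) * p x = ∫ x, w x * laplacian p x) ∧
      ∀ (Ω : Set (Euc N)) (h : Euc N → ℝ), IsOpen Ω → closure D ⊆ Ω → (∀ x, 0 ≤ h x) →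
        (∀ x, h x ≤ L) →
        NegLapLE Ω (fun x => -h x) (fun x => h x ^ q - k * max (min (u x) M - h x) 0) →
        ∀ᵐ x, w x ≤ h x := by
  have hL0 := hM0.trans hML
  have hLq : 0 ≤ q * L ^ (q - 1) := mul_nonneg (by linarith) (Real.rpow_nonneg hL0 _)
  have hP : ∀ x t, 0 ≤ t → max (min (u x) M - t) 0 ≤ M := fun x t ht =>
    max_le (by linarith [min_le_right (u x) M]) hM0
  obtain ⟨w, hwm, hw0, hwM, hwD, hweq, hcomp⟩ := exists_semilinear (D := D)
    (lam := q * L ^ (q - 1) + k + 1) (G := fun x t => t ^ q - k * max (min (u x) M - t) 0)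
    (M := M) (L := L) (B := L ^ q + k * M) hD hDb (by linarith) hM0 hML
    ((measurable_snd.pow_const q).sub
      (((((hum.comp measurable_fst).min measurable_const).sub measurable_snd).max
        measurable_const).const_mul k))
    (fun x t ht htL => by
      have h1 : t ^ q ≤ L ^ q := Real.rpow_le_rpow ht htL (by linarith)
      have h2 : 0 ≤ t ^ q := Real.rpow_nonneg ht q
      have h3 := mul_le_mul_of_nonneg_left (hP x t ht) hk
      have h4 : 0 ≤ k * max (min (u x) M - t) 0 := mul_nonneg hk (le_max_right _ _)
      rw [abs_le]; constructor <;> linarith)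
    (fun x s t hs hst htL => by
      have h1 : s ^ q ≤ t ^ q := Real.rpow_le_rpow hs hst (by linarith)
      have h2 := rpow_sub_rpow_le hq.le hs hst
      have h3 : t ^ (q - 1) ≤ L ^ (q - 1) :=
        Real.rpow_le_rpow (hs.trans hst) htL (by linarith)
      have h4 : max (min (u x) M - t) 0 ≤ max (min (u x) M - s) 0 :=
        max_le_max (by linarith) le_rfl
      have h5 : max (min (u x) M - s) 0 ≤ max (min (u x) M - t) 0 + (t - s) := by
        refine max_le ?_ (by linarith [le_max_right (min (u x) M - t) 0])
        linarith [le_max_left (min (u x) M - t) 0]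
      have h6 := mul_le_mul_of_nonneg_left h4 hk
      have h7 := mul_le_mul_of_nonneg_left h5 hk
      have h8 : q * t ^ (q - 1) * (t - s) ≤ q * L ^ (q - 1) * (t - s) :=
        mul_le_mul_of_nonneg_right (mul_le_mul_of_nonneg_left h3 (by linarith)) (by linarith)
      constructor
      · linarith
      · nlinarith)
    (fun x => by
      have h1 : (0 : ℝ) ^ q = 0 := Real.zero_rpow (by linarith)
      have h2 : 0 ≤ k * max (min (u x) M - 0) 0 := mul_nonneg hk (le_max_right _ _)
      simp only [h1]; linarith)
    (fun x => by
      have h1 : max (min (u x) M - M) 0 = 0 := max_eq_right (by linarith [min_le_right (u x) M])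
      simp only [h1, mul_zero, sub_zero]
      exact Real.rpow_nonneg hM0 q)
  refine ⟨w, hwm, hw0, hwM, hwD, fun p hp => ?_, hcomp⟩
  have h0 := hweq p hp
  have hgm : Measurable fun x => w x ^ q - k * max (min (u x) M - w x) 0 :=
    (hwm.pow_const q).sub ((((hum.min measurable_const).sub hwm).max measurable_const).const_mul k)
  have i1 : Integrable fun x => (w x ^ q - k * max (min (u x) M - w x) 0) * p x := by
    refine hp.integrable_bdd_mul (C := M ^ q + k * M) hgm fun x => ?_
    have h1 : w x ^ q ≤ M ^ q := Real.rpow_le_rpow (hw0 x) (hwM x) (by linarith)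
    have h2 : 0 ≤ w x ^ q := Real.rpow_nonneg (hw0 x) q
    have h3 := mul_le_mul_of_nonneg_left (hP x (w x) (hw0 x)) hk
    have h4 : 0 ≤ k * max (min (u x) M - w x) 0 := mul_nonneg hk (le_max_right _ _)
    have h5 : 0 ≤ M ^ q := Real.rpow_nonneg hM0 q
    rw [abs_le]; constructor <;> linarith
  have i2 : Integrable fun x => w x * laplacian p x :=
    hp.laplacian.integrable_bdd_mul (C := M) hwm fun x => by
      rw [abs_of_nonneg (hw0 x)]; exact hwM x
  have h1 : ∫ x, (w x ^ q - k * max (u x - w x) 0) * p x =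
      ∫ x, (w x ^ q - k * max (min (u x) M - w x) 0) * p x := by
    refine integral_congr_ae ?_
    filter_upwards [huM] with x hx
    by_cases hxD : x ∈ D
    · simp only [min_eq_left (hx hxD)]
    · simp only [hp.eq_zero hxD, mul_zero]
  rw [h1, ← sub_eq_zero, ← integral_sub i1 i2]
  refine (integral_congr_ae (ae_of_all _ fun x => ?_)).trans h0
  ring

/-- Supersolutions that dominate the obstacle dominate the solution of the penalized problem. -/
lemma le_of_penalized {k M : ℝ} {U : Euc N → ℝ} (hq : 1 < q) (hΩ : IsOpen Ω)
    (hM0 : 0 ≤ M) (hu0 : ∀ x, 0 ≤ u x) (huU : ∀ x, u x ≤ U x)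
    (hUm : Measurable U)
    (hcomp : ∀ h : Euc N → ℝ, (∀ x, 0 ≤ h x) → (∀ x, h x ≤ M) →
        NegLapLE Ω (fun x => -h x) (fun x => h x ^ q - k * max (min (u x) M - h x) 0) →
        ∀ᵐ x, w x ≤ h x)
    (hU : NegLapLE Ω (fun x => -U x) fun x => U x ^ q) : ∀ᵐ x, w x ≤ U x := by
  have hU0 : ∀ x, 0 ≤ U x := fun x => (hu0 x).trans (huU x)
  have key : ∀ ε : ℝ, 0 < ε → ∀ᵐ x, w x ≤ U x + ε := by
    intro ε hε
    set h : Euc N → ℝ := fun x => M - smoothPos ε (M - U x) with hh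
    have h1 : ∀ x, min (U x) M ≤ h x := fun x => by
      have := smoothPos_le_max hε (M - U x)
      rcases le_total (M - U x) 0 with h' | h'
      · rw [max_eq_right h'] at this
        exact (min_le_right _ _).trans (by simp only [hh]; linarith)
      · rw [max_eq_left h'] at this
        exact (min_le_left _ _).trans (by simp only [hh]; linarith)
    have h0 : ∀ x, 0 ≤ h x := fun x => (le_min (hU0 x) hM0).trans (h1 x)
    have hM : ∀ x, h x ≤ M := fun x => by
      have := smoothPos_nonneg hε (M - U x)
      simp only [hh]; linarith
    have hP : ∀ x, max (min (u x) M - h x) 0 = 0 := fun x =>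
      max_eq_right (by linarith [h1 x, min_le_min_right M (huU x)])
    have hhm : Measurable h :=
      measurable_const.sub ((continuous_smoothPos ε).measurable.comp (measurable_const.sub hUm))
    have hK := ((hU.add (negLapLE_const Ω M)).smoothPos hΩ hε).add (negLapLE_const Ω (-M))
    have hn : NegLapLE Ω (fun x => -h x)
        (fun x => h x ^ q - k * max (min (u x) M - h x) 0) := by
      refine (hK.congr_left (ae_of_all _ fun x _ => ?_)).mono_right (fun K _ hKc => ?_)
        (ae_of_all _ fun x _ => ?_)
      · simp only [hh]
        rw [neg_add_eq_sub]; ring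
      · simp only [hP, mul_zero, sub_zero]
        refine Integrable.mono' (integrableOn_const (C := M ^ q) hKc.measure_lt_top.ne)
          (hhm.pow_const q).aestronglyMeasurable (ae_of_all _ fun x => ?_)
        rw [Real.norm_of_nonneg (Real.rpow_nonneg (h0 x) q)]
        exact Real.rpow_le_rpow (h0 x) (hM x) (by linarith)
      · simp only [hP, mul_zero, sub_zero, add_zero]
        rcases le_total (U x) M with h' | h'
        · refine (mul_le_of_le_one_left (Real.rpow_nonneg (hU0 x) q)
            (deriv_smoothPos_le_one ε _)).trans ?_
          exact Real.rpow_le_rpow (hU0 x) (by simpa [h'] using h1 x) (by linarith)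
        · rw [deriv_smoothPos_of_nonpos hε (by linarith), zero_mul]
          exact Real.rpow_nonneg (h0 x) q
    filter_upwards [hcomp h h0 hM hn] with x hx
    have := max_sub_le_smoothPos hε (M - U x)
    refine hx.trans ?_
    simp only [hh]
    linarith [le_max_left (M - U x) 0]
  have h2 : ∀ n : ℕ, ∀ᵐ x, w x ≤ U x + 1 / ((n : ℝ) + 1) := fun n => key _ (by positivity)
  filter_upwards [ae_all_iff.2 h2] with x hx
  have t : Tendsto (fun n : ℕ => U x + 1 / ((n : ℝ) + 1)) atTop (𝓝 (U x)) := by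
    simpa using tendsto_one_div_add_atTop_nhds_zero_nat.const_add (U x)
  exact ge_of_tendsto' t hx

end Penalized

section Estimates

variable {N : ℕ} {u w φ : Euc N → ℝ} {D Ω K : Set (Euc N)} {q : ℝ}

lemma exists_exhaustion (Ω : Set (Euc N)) (hb : Bornology.IsBounded Ω) (hΩ : IsOpen Ω) :
    ∃ D : ℕ → Set (Euc N), (∀ k, IsOpen (D k)) ∧ (∀ k, Bornology.IsBounded (D k)) ∧
      (∀ k, closure (D k) ⊆ D (k + 1)) ∧ Monotone D ∧ (∀ k, D k ⊆ Ω) ∧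
      ∀ K ⊆ Ω, IsCompact K → ∃ k, K ⊆ D k := by
  set D : ℕ → Set (Euc N) := fun k => {x | ((k : ℝ≥0∞) + 1)⁻¹ < Metric.infEDist x Ωᶜ} with hD
  have hcont : Continuous fun x : Euc N => Metric.infEDist x Ωᶜ := Metric.continuous_infEDist
  have hDo : ∀ k, IsOpen (D k) := fun k => isOpen_lt continuous_const hcont
  have hDc : ∀ k, closure (D k) ⊆ D (k + 1) := fun k x hx => by
    have h1 : ((k : ℝ≥0∞) + 1)⁻¹ ≤ Metric.infEDist x Ωᶜ :=
      closure_minimal (fun y hy => le_of_lt hy) (isClosed_le continuous_const hcont) hx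
    refine lt_of_lt_of_le ?_ h1
    rw [ENNReal.inv_lt_inv]
    exact_mod_cast Nat.lt_succ_self (k + 1)
  have hmono : Monotone D := monotone_nat_of_le_succ fun k => subset_closure.trans (hDc k)
  have hDΩ : ∀ k, D k ⊆ Ω := fun k x hx => by
    by_contra h
    have : Metric.infEDist x Ωᶜ = 0 := Metric.infEDist_zero_of_mem h
    simp [hD, this] at hx
  refine ⟨D, hDo, fun k => hb.subset (hDΩ k), hDc, hmono, hDΩ, fun K hK hKc => ?_⟩
  refine hKc.elim_directed_cover D hDo (fun x hx => ?_) hmono.directed_le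
  have h0 : Metric.infEDist x Ωᶜ ≠ 0 := fun h => by
    have := (Metric.mem_closure_iff_infEDist_zero).2 h
    rw [hΩ.isClosed_compl.closure_eq] at this
    exact this (hK hx)
  obtain ⟨n, hn⟩ := ENNReal.exists_inv_nat_lt h0
  exact mem_iUnion.2 ⟨n, lt_of_le_of_lt (ENNReal.inv_le_inv.2 le_self_add) hn⟩

lemma IsTestFun.abs_laplacian_pow_le {ψ : Euc N → ℝ} (hψ : IsTestFun Ω ψ) (h0 : ∀ x, 0 ≤ ψ x)
    (h1 : ∀ x, ψ x ≤ 1) (s : ℕ) :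
    ∃ C, 0 ≤ C ∧ ∀ x, |_root_.laplacian (fun y => ψ y ^ (s + 2)) x| ≤ C * ψ x ^ s := by
  obtain ⟨C₁, hC₁, hC₁'⟩ := hψ.laplacian.exists_bound
  have hp : ∀ i, IsTestFun Ω (pderiv i ψ) := fun i =>
    ⟨contDiff_pderiv hψ.1 i, hasCompactSupport_pderiv hψ.2.1 i,
      (tsupport_pderiv_subset i).trans hψ.2.2⟩
  choose G hG0 hG using fun i => (hp i).exists_bound
  set S := ∑ i, G i ^ 2
  have hS : ∀ x, ∑ i, (pderiv i ψ x) ^ 2 ≤ S := fun x =>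
    Finset.sum_le_sum fun i _ => by
      rw [← sq_abs]; exact pow_le_pow_left₀ (abs_nonneg _) (hG i x) 2
  have hS0 : 0 ≤ S := Finset.sum_nonneg fun i _ => sq_nonneg _
  refine ⟨(s + 2) * C₁ + (s + 2) * (s + 1) * S, by positivity, fun x => ?_⟩
  have hd : deriv (fun t : ℝ => t ^ (s + 2)) = fun t => ((s : ℝ) + 2) * t ^ (s + 1) := by
    ext t; simp
  have hd2 : deriv (fun t : ℝ => ((s : ℝ) + 2) * t ^ (s + 1)) =
      fun t => ((s : ℝ) + 2) * ((s + 1) * t ^ s) := by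
    ext t; simp
  rw [laplacian_comp (m := fun t => t ^ (s + 2)) (contDiff_id.pow _) hψ.1, hd, hd2]
  have hs := pow_nonneg (h0 x) s
  have hS0' : 0 ≤ ∑ i, (pderiv i ψ x) ^ 2 := Finset.sum_nonneg fun i _ => sq_nonneg _
  refine (abs_add_le _ _).trans ?_
  rw [add_mul]
  refine add_le_add ?_ ?_
  · rw [abs_mul, abs_of_nonneg (mul_nonneg (by positivity) (pow_nonneg (h0 x) _))]
    have h2 : ψ x ^ (s + 1) ≤ ψ x ^ s := pow_le_pow_of_le_one (h0 x) (h1 x) (Nat.le_succ s)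
    calc ((s : ℝ) + 2) * ψ x ^ (s + 1) * |_root_.laplacian ψ x|
        ≤ ((s : ℝ) + 2) * ψ x ^ s * C₁ := by
          gcongr
          exact hC₁' x
      _ = _ := by ring
  · rw [abs_of_nonneg (by positivity)]
    calc ((s : ℝ) + 2) * ((s + 1) * ψ x ^ s) * ∑ i, (pderiv i ψ x) ^ 2
        ≤ ((s : ℝ) + 2) * ((s + 1) * ψ x ^ s) * S := by
          gcongr
          exact hS x
      _ = _ := by ring

lemma exists_mul_pow_le (hq : 1 < q) {s : ℕ} (hs : 2 / (q - 1) ≤ s) {C : ℝ} (hC : 0 ≤ C) :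
    ∃ A, 0 ≤ A ∧ ∀ a t : ℝ, 0 ≤ a → a ≤ 1 → 0 ≤ t →
      t * (C * a ^ s) ≤ 1 / 2 * t ^ q * a ^ (s + 2) + A := by
  have hq' : 0 < q - 1 := by linarith
  refine ⟨C * (2 * C) ^ (q - 1)⁻¹, by positivity, fun a t ha ha1 ht => ?_⟩
  rcases le_total (2 * C) (t ^ (q - 1) * a ^ 2) with h | h
  · have h1 : t ^ q = t ^ (q - 1) * t := by
      rcases ht.eq_or_lt with rfl | ht'
      · simp [Real.zero_rpow (show q ≠ 0 by linarith)]
      · rw [← Real.rpow_add_one ht'.ne']; congr 1; ring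
    have h2 := mul_le_mul_of_nonneg_right h (mul_nonneg ht (pow_nonneg ha s))
    have h3 : 0 ≤ C * (2 * C) ^ (q - 1)⁻¹ := by positivity
    rw [h1, pow_add]
    nlinarith
  · have h1 : t * a ^ (s : ℕ) ≤ (2 * C) ^ (q - 1)⁻¹ := by
      have h2 : (t ^ (q - 1) * a ^ 2) ^ (q - 1)⁻¹ ≤ (2 * C) ^ (q - 1)⁻¹ :=
        Real.rpow_le_rpow (by positivity) h (by positivity)
      refine le_trans ?_ h2
      rw [Real.mul_rpow (by positivity) (by positivity), ← Real.rpow_mul ht,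
        mul_inv_cancel₀ hq'.ne', Real.rpow_one]
      refine mul_le_mul_of_nonneg_left ?_ ht
      rcases ha.eq_or_lt with rfl | ha'
      · have : s ≠ 0 := by
          rintro rfl
          have : 0 < 2 / (q - 1) := by positivity
          simp at hs
          linarith
        rw [zero_pow this]; positivity
      · rw [← Real.rpow_natCast, ← Real.rpow_natCast, ← Real.rpow_mul ha]
        refine Real.rpow_le_rpow_of_exponent_ge ha' ha1 ?_
        rw [← div_eq_mul_inv]; exact_mod_cast hs
    have h2 : 0 ≤ 1 / 2 * t ^ q * a ^ (s + 2) := by positivity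
    have h3 := mul_le_mul_of_nonneg_left h1 hC
    linarith

/-- Cut-off functions adapted to the absorption term. -/
lemma exists_isTestFun_absorb (hq : 1 < q) (hΩ : IsOpen Ω) (hK : IsCompact K) (hKΩ : K ⊆ Ω) :
    ∃ φ, IsTestFun Ω φ ∧ (∀ x, 0 ≤ φ x) ∧ (∀ x, φ x ≤ 1) ∧ (∀ x ∈ K, φ x = 1) ∧
      ∃ A, 0 ≤ A ∧ ∀ x t, 0 ≤ t → t * laplacian φ x ≤ 1 / 2 * t ^ q * φ x + A := by
  obtain ⟨ψ, hψ, h0, h1, hψK⟩ := exists_isTestFun_eq_one hΩ hK hKΩ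
  set s := ⌈2 / (q - 1)⌉₊
  obtain ⟨C, hC0, hC⟩ := hψ.abs_laplacian_pow_le h0 h1 s
  obtain ⟨A, hA0, hA⟩ := exists_mul_pow_le hq (s := s) (Nat.le_ceil _) hC0
  refine ⟨fun x => ψ x ^ (s + 2), ⟨hψ.1.pow _, ?_, ?_⟩, fun x => pow_nonneg (h0 x) _,
    fun x => pow_le_one₀ (h0 x) (h1 x), fun x hx => by simp [hψK x hx], A, hA0, fun x t ht => ?_⟩
  · exact hψ.2.1.comp_left (g := fun t : ℝ => t ^ (s + 2)) (by simp)
  · refine (closure_mono fun x hx => ?_).trans hψ.2.2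
    exact fun h => hx (by simp [h])
  · refine le_trans (mul_le_mul_of_nonneg_left ((le_abs_self _).trans (hC x)) ht) ?_
    exact hA _ t (h0 x) (h1 x) ht

/-- Bounded measurable solutions of the penalized problem. -/
structure IsPenalizedSol (q k : ℝ) (D : Set (Euc N)) (u w : Euc N → ℝ) : Prop where
  measurable : Measurable w
  nonneg : ∀ x, 0 ≤ w x
  bdd : ∃ M, ∀ x, w x ≤ M
  eq : ∀ p, IsTestFun D p →
    ∫ x, (w x ^ q - k * max (u x - w x) 0) * p x = ∫ x, w x * laplacian p x

namespace IsPenalizedSol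

variable {k : ℝ}

lemma mono_set (h : IsPenalizedSol q k Ω u w) (hD : D ⊆ Ω) : IsPenalizedSol q k D u w :=
  ⟨h.1, h.2, h.3, fun p hp => h.eq p (hp.mono hD)⟩

lemma integrableOn (h : IsPenalizedSol q k D u w) (hK : IsCompact K) : IntegrableOn w K := by
  obtain ⟨M, hM⟩ := h.bdd
  refine Integrable.mono' (integrableOn_const (C := M) hK.measure_lt_top.ne)
    h.measurable.aestronglyMeasurable (ae_of_all _ fun x => ?_)
  rw [Real.norm_of_nonneg (h.nonneg x)]; exact hM x

lemma integrableOn_rpow (h : IsPenalizedSol q k D u w) (hq : 0 ≤ q) (hK : IsCompact K) :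
    IntegrableOn (fun x => w x ^ q) K := by
  obtain ⟨M, hM⟩ := h.bdd
  refine Integrable.mono' (integrableOn_const (C := M ^ q) hK.measure_lt_top.ne)
    (h.measurable.pow_const q).aestronglyMeasurable (ae_of_all _ fun x => ?_)
  rw [Real.norm_of_nonneg (Real.rpow_nonneg (h.nonneg x) q)]
  exact Real.rpow_le_rpow (h.nonneg x) (hM x) hq

lemma posPart_le (h : IsPenalizedSol q k D u w) (hu0 : ∀ x, 0 ≤ u x) (x : Euc N) :
    max (u x - w x) 0 ≤ u x :=
  max_le (by linarith [h.nonneg x]) (hu0 x)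

lemma integrableOn_posPart (h : IsPenalizedSol q k D u w) (hum : Measurable u)
    (hu0 : ∀ x, 0 ≤ u x) (hui : IntegrableOn u K) :
    IntegrableOn (fun x => max (u x - w x) 0) K := by
  refine Integrable.mono' hui
    ((hum.sub h.measurable).max measurable_const).aestronglyMeasurable (ae_of_all _ fun x => ?_)
  rw [Real.norm_of_nonneg (le_max_right _ _)]
  exact h.posPart_le hu0 x

/-- Testing the inequality for the excess `(u - w)₊` over the solution. -/
lemma mul_integral_le (h : IsPenalizedSol q k D u w) (hq : 0 ≤ q) (hk : 0 ≤ k) (hD : IsOpen D)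
    (hum : Measurable u) (hu0 : ∀ x, 0 ≤ u x) (hu : NegLapLE D u fun x => -u x ^ q)
    (hφ : IsTestFun D φ) (hφ0 : ∀ x, 0 ≤ φ x) :
    k * ∫ x, max (u x - w x) 0 * φ x ≤ ∫ x, max (u x - w x) 0 * |laplacian φ x| := by
  have hPi : ∀ K ⊆ D, IsCompact K → IntegrableOn (fun x => max (u x - w x) 0) K :=
    fun K hK hKc => h.integrableOn_posPart hum hu0 (hu.1 K hK hKc)
  have hi1 := hφ.integrable_mul_of_locally hPi
  have hi2 : Integrable fun x => max (u x - w x) 0 * |laplacian φ x| := by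
    refine (hφ.laplacian.integrable_mul_of_locally hPi).abs.congr (ae_of_all _ fun x => ?_)
    simp only [abs_mul, abs_of_nonneg (le_max_right (u x - w x) 0)]
  have hw : NegLapLE D (fun x => -(w x)) fun x => w x ^ q - k * max (u x - w x) 0 :=
    negLapLE_of_integral_eq (fun K _ hKc => h.integrableOn hKc)
      (fun K hK hKc => (h.integrableOn_rpow hq hKc).sub ((hPi K hK hKc).const_mul k)) h.eq
  have key : ∀ ε : ℝ, 0 < ε →
      k * ∫ x, max (u x - w x) 0 * φ x ≤
        (∫ x, max (u x - w x) 0 * |laplacian φ x|) + ε * (k * ∫ x, φ x) := by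
    intro ε hε
    have hK := (hu.add hw).smoothPos hD hε
    have hmi : ∀ K ⊆ D, IsCompact K → IntegrableOn (fun x => smoothPos ε (u x + -w x)) K := hK.1
    have hK2 := (hK.mono_right (f' := fun x => -(k * smoothPos ε (u x + -w x)))
      (fun K hK hKc => ((hmi K hK hKc).const_mul k).neg) (ae_of_all _ fun x _ => ?_)).2.2 φ hφ hφ0
    · have j1 := hφ.integrable_mul_of_locally hmi
      have j2 := hφ.laplacian.integrable_mul_of_locally hmi
      have e1 : ∫ x, -(k * smoothPos ε (u x + -w x)) * φ x =
          -(k * ∫ x, smoothPos ε (u x + -w x) * φ x) := by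
        rw [← integral_const_mul, ← integral_neg]
        exact integral_congr_ae (ae_of_all _ fun x => by ring)
      have e2 : ∫ x, -(smoothPos ε (u x + -w x)) * laplacian φ x =
          -∫ x, smoothPos ε (u x + -w x) * laplacian φ x := by
        rw [← integral_neg]
        exact integral_congr_ae (ae_of_all _ fun x => by ring)
      rw [e1, e2] at hK2
      have e3 : ∫ x, smoothPos ε (u x + -w x) * laplacian φ x ≤
          ∫ x, max (u x - w x) 0 * |laplacian φ x| := by
        refine integral_mono j2 hi2 fun x => ?_
        have := smoothPos_le_max hε (u x + -w x)
        rw [← sub_eq_add_neg] at this ⊢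
        exact (mul_le_mul_of_nonneg_left (le_abs_self _) (smoothPos_nonneg hε _)).trans
          (mul_le_mul_of_nonneg_right this (abs_nonneg _))
      have e4 : (∫ x, max (u x - w x) 0 * φ x) - ε * ∫ x, φ x ≤
          ∫ x, smoothPos ε (u x + -w x) * φ x := by
        rw [← integral_const_mul, ← integral_sub hi1 (hφ.integrable.const_mul ε)]
        refine integral_mono (hi1.sub (hφ.integrable.const_mul ε)) j1 fun x => ?_
        have := max_sub_le_smoothPos hε (u x - w x)
        simp only [← sub_eq_add_neg]
        rw [← sub_mul]
        exact mul_le_mul_of_nonneg_right this (hφ0 x)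
      have e5 := mul_le_mul_of_nonneg_left e4 hk
      linarith
    · rcases le_or_gt (u x + -w x) 0 with h' | h'
      · rw [deriv_smoothPos_of_nonpos hε h', smoothPos_of_nonpos hε h']; simp
      · have h1 : w x ^ q ≤ u x ^ q := Real.rpow_le_rpow (h.nonneg x) (by linarith) hq
        have h2 := smoothPos_le_deriv_mul hε (u x + -w x)
        have h3 := deriv_smoothPos_nonneg ε (u x + -w x)
        rw [← sub_eq_add_neg] at *
        have h4 := mul_le_mul_of_nonneg_left h1 h3
        have h5 := mul_le_mul_of_nonneg_left h2 hk
        linarith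
  have ht : Tendsto (fun ε : ℝ => (∫ x, max (u x - w x) 0 * |laplacian φ x|) +
      ε * (k * ∫ x, φ x)) (𝓝[>] 0) (𝓝 (∫ x, max (u x - w x) 0 * |laplacian φ x|)) := by
    have h1 : Continuous fun ε : ℝ => (∫ x, max (u x - w x) 0 * |laplacian φ x|) +
        ε * (k * ∫ x, φ x) := by fun_prop
    have h2 := (h1.tendsto 0).mono_left (nhdsWithin_le_nhds (s := Ioi 0))
    simpa using h2
  exact ge_of_tendsto ht (eventually_nhdsWithin_of_forall fun ε hε => key ε hε)

end IsPenalizedSol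

lemma IsTestFun.exists_dominating (hD : IsOpen D) (hφ : IsTestFun D φ) :
    ∃ χ, IsTestFun D χ ∧ (∀ x, 0 ≤ χ x) ∧ ∀ x, |φ x| ≤ χ x := by
  obtain ⟨C, hC0, hC⟩ := hφ.exists_bound
  obtain ⟨ψ, hψ, h0, -, h1⟩ := exists_isTestFun_eq_one hD hφ.2.1 hφ.2.2
  refine ⟨_, hψ.const_mul C, fun x => mul_nonneg hC0 (h0 x), fun x => ?_⟩
  by_cases hx : x ∈ tsupport φ
  · rw [h1 x hx, mul_one]; exact hC x
  · rw [image_eq_zero_of_notMem_tsupport hx, abs_zero]; exact mul_nonneg hC0 (h0 x)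

lemma exists_penalty_bound (hq : 0 ≤ q) (hD : IsOpen D) (hum : Measurable u)
    (hu0 : ∀ x, 0 ≤ u x) (hu : NegLapLE D u fun x => -u x ^ q) (hφ : IsTestFun D φ)
    (hφ0 : ∀ x, 0 ≤ φ x) :
    ∃ A, 0 ≤ A ∧ ∀ k w, 0 ≤ k → IsPenalizedSol q k D u w →
      k ^ 2 * ∫ x, max (u x - w x) 0 * φ x ≤ A := by
  obtain ⟨χ, hχ, hχ0, hχφ⟩ := hφ.laplacian.exists_dominating hD
  have hi : Integrable fun x => u x * |laplacian χ x| := by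
    refine (hχ.laplacian.integrable_mul_of_locally hu.1).abs.congr (ae_of_all _ fun x => ?_)
    simp only [abs_mul, abs_of_nonneg (hu0 x)]
  refine ⟨∫ x, u x * |laplacian χ x|,
    integral_nonneg fun x => mul_nonneg (hu0 x) (abs_nonneg _), fun k w hk hw => ?_⟩
  have hPi : ∀ K ⊆ D, IsCompact K → IntegrableOn (fun x => max (u x - w x) 0) K :=
    fun K hK hKc => hw.integrableOn_posPart hum hu0 (hu.1 K hK hKc)
  have hiabs : ∀ {p : Euc N → ℝ}, IsTestFun D p →
      Integrable fun x => max (u x - w x) 0 * |p x| := fun {p} hp => by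
    refine (hp.integrable_mul_of_locally hPi).abs.congr (ae_of_all _ fun x => ?_)
    simp only [abs_mul, abs_of_nonneg (le_max_right (u x - w x) 0)]
  have h1 := hw.mul_integral_le hq hk hD hum hu0 hu hφ hφ0
  have h2 := hw.mul_integral_le hq hk hD hum hu0 hu hχ hχ0
  have h3 : ∫ x, max (u x - w x) 0 * |laplacian φ x| ≤ ∫ x, max (u x - w x) 0 * χ x :=
    integral_mono (hiabs hφ.laplacian) (hχ.integrable_mul_of_locally hPi) fun x =>
      mul_le_mul_of_nonneg_left (hχφ x) (le_max_right _ _)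
  have h4 : ∫ x, max (u x - w x) 0 * |laplacian χ x| ≤ ∫ x, u x * |laplacian χ x| :=
    integral_mono (hiabs hχ.laplacian) hi fun x =>
      mul_le_mul_of_nonneg_right (hw.posPart_le hu0 x) (abs_nonneg _)
  have h5 := mul_le_mul_of_nonneg_left (h1.trans h3) hk
  nlinarith

/-- Interior `L^q` bounds that do not depend on the penalty. -/
lemma exists_integral_rpow_bound (hq : 1 < q) (hD : IsOpen D) (hum : Measurable u)
    (hu0 : ∀ x, 0 ≤ u x) (hu : NegLapLE D u fun x => -u x ^ q) (hK : IsCompact K) (hKD : K ⊆ D) :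
    ∃ A, 0 ≤ A ∧ ∀ k w, 1 ≤ k → IsPenalizedSol q k D u w → ∫ x in K, w x ^ q ≤ A := by
  obtain ⟨φ, hφ, hφ0, hφ1, hφK, A, hA0, hA⟩ := exists_isTestFun_absorb hq hD hK hKD
  obtain ⟨B, hB0, hB⟩ := exists_penalty_bound (by linarith) hD hum hu0 hu hφ hφ0
  set V := volume.real (tsupport φ)
  have hV : 0 ≤ V := measureReal_nonneg
  refine ⟨2 * (A * V + B), by positivity, fun k w hk hw => ?_⟩
  have hPi : ∀ K ⊆ D, IsCompact K → IntegrableOn (fun x => max (u x - w x) 0) K :=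
    fun K hK hKc => hw.integrableOn_posPart hum hu0 (hu.1 K hK hKc)
  have i1 := hφ.integrable_mul_of_locally hPi
  have i2 := hφ.integrable_mul_of_locally fun K _ hKc =>
    hw.integrableOn_rpow (show (0 : ℝ) ≤ q by linarith) hKc
  have i3 := hφ.laplacian.integrable_mul_of_locally fun K _ hKc => hw.integrableOn hKc
  have hm : MeasurableSet (tsupport φ) := (isClosed_tsupport φ).measurableSet
  have i4 : Integrable ((tsupport φ).indicator fun _ => A) :=
    (integrable_indicator_iff hm).2 (integrableOn_const hφ.2.1.measure_lt_top.ne)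
  have h1 : (∫ x, w x ^ q * φ x) - k * ∫ x, max (u x - w x) 0 * φ x =
      ∫ x, w x * laplacian φ x := by
    rw [← hw.eq φ hφ, ← integral_const_mul, ← integral_sub i2 (i1.const_mul k)]
    exact integral_congr_ae (ae_of_all _ fun x => by ring)
  have h2 : ∫ x, w x * laplacian φ x ≤ 1 / 2 * (∫ x, w x ^ q * φ x) + A * V := by
    have e : ∫ x, (tsupport φ).indicator (fun _ => A) x = A * V := by
      rw [integral_indicator_const _ hm, smul_eq_mul, mul_comm]
    rw [← e, ← integral_const_mul, ← integral_add (i2.const_mul _) i4]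
    refine integral_mono i3 ((i2.const_mul _).add i4) fun x => ?_
    by_cases hx : x ∈ tsupport φ
    · simp only [indicator_of_mem hx]
      rw [← mul_assoc]
      exact hA x (w x) (hw.nonneg x)
    · simp only [indicator_of_notMem hx,
        laplacian_eq_zero_of_notMem_tsupport hx, image_eq_zero_of_notMem_tsupport hx]
      simp
  have h3 := hB k w (by linarith) hw
  have h4 : 0 ≤ ∫ x, max (u x - w x) 0 * φ x :=
    integral_nonneg fun x => mul_nonneg (le_max_right _ _) (hφ0 x)
  have h5 : k * ∫ x, max (u x - w x) 0 * φ x ≤ B := by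
    refine le_trans (mul_le_mul_of_nonneg_right ?_ h4) h3
    nlinarith
  have h6 : ∫ x in K, w x ^ q ≤ ∫ x, w x ^ q * φ x := by
    rw [setIntegral_congr_fun (g := fun x => w x ^ q * φ x) hK.isClosed.measurableSet
      fun x hx => by simp only [hφK x hx, mul_one]]
    exact setIntegral_le_integral i2 (ae_of_all _ fun x =>
      mul_nonneg (Real.rpow_nonneg (hw.nonneg x) q) (hφ0 x))
  linarith

end Estimates

section Minimal

variable {N : ℕ} {u : Euc N → ℝ} {Ω : Set (Euc N)} {q : ℝ}

lemma le_one_add_rpow (hq : 1 ≤ q) {t : ℝ} (ht : 0 ≤ t) : t ≤ 1 + t ^ q := by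
  rcases le_total t 1 with h | h
  · linarith [Real.rpow_nonneg ht q]
  · have := Real.rpow_le_rpow_of_exponent_le h hq
    rw [Real.rpow_one] at this
    linarith

/-- An exhaustion by open sets together with increasing solutions of penalized problems, whose
penalties tend to infinity. -/
lemma exists_penalized_seq (hq : 1 < q) (hΩ : IsOpen Ω) (hb : Bornology.IsBounded Ω)
    (hum : Measurable u) (hu0 : ∀ x, 0 ≤ u x)
    (hub : ∀ K ⊆ Ω, IsCompact K → ∃ M : ℝ, 0 ≤ M ∧ ∀ᵐ x, x ∈ K → u x ≤ M) :
    ∃ (D : ℕ → Set (Euc N)) (w : ℕ → Euc N → ℝ), (∀ k, IsOpen (D k)) ∧ Monotone D ∧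
      (∀ k, D k ⊆ Ω) ∧ (∀ K ⊆ Ω, IsCompact K → ∃ k, K ⊆ D k) ∧
      (∀ k : ℕ, IsPenalizedSol q ((k : ℝ) + 1) (D k) u (w k)) ∧ (∀ k, ∀ x ∉ D k, w k x = 0) ∧
      (∀ᵐ x, Monotone fun k => w k x) ∧
      ∀ U : Euc N → ℝ, Measurable U → (∀ x, u x ≤ U x) →
        NegLapLE Ω (fun x => -U x) (fun x => U x ^ q) → ∀ k, ∀ᵐ x, w k x ≤ U x := by
  obtain ⟨D, hDo, hDb, hDc, hDm, hDΩ, hDK⟩ := exists_exhaustion Ω hb hΩ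
  have hcl : ∀ k, closure (D k) ⊆ Ω := fun k => (hDc k).trans (hDΩ _)
  choose M hM0 hM using fun k => hub _ (hcl k) (hDb k).isCompact_closure
  set L : ℕ → ℝ := fun k => ∑ i ∈ Finset.range (k + 1), M i
  have hL0 : ∀ k, 0 ≤ L k := fun k => Finset.sum_nonneg fun i _ => hM0 i
  have hLs : ∀ k, L k ≤ L (k + 1) := fun k => by
    simp only [L]
    rw [Finset.sum_range_succ _ (k + 1)]
    linarith [hM0 (k + 1)]
  have hML : ∀ k, M k ≤ L k := fun k =>
    Finset.single_le_sum (f := M) (fun i _ => hM0 i) (Finset.self_mem_range_succ k)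
  have huL : ∀ k, ∀ᵐ x, x ∈ D k → u x ≤ L k := fun k => by
    filter_upwards [hM k] with x hx hxD
    exact (hx (subset_closure hxD)).trans (hML k)
  have hk0 : ∀ k : ℕ, (0 : ℝ) ≤ (k : ℝ) + 1 := fun k => by positivity
  choose w hwm hw0 hwL hwD hweq hcomp using fun k : ℕ =>
    exists_penalized hq (hDo k) (hDb k) (hk0 k) (hL0 k) (hLs k) hum (huL k)
  have hS : ∀ k : ℕ, IsPenalizedSol q ((k : ℝ) + 1) (D k) u (w k) := fun k =>
    ⟨hwm k, hw0 k, ⟨L k, hwL k⟩, hweq k⟩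
  refine ⟨D, w, hDo, hDm, hDΩ, hDK, hS, hwD, ?_, fun U hUm huU hU k => ?_⟩
  · have hstep : ∀ k, ∀ᵐ x, w k x ≤ w (k + 1) x := fun k => by
      refine hcomp k (D (k + 1)) (w (k + 1)) (hDo _) (hDc k) (hw0 _) (hwL _) ?_
      have hui : ∀ K ⊆ Ω, IsCompact K → IntegrableOn u K := fun K hK hKc => by
        obtain ⟨C, hC0, hC⟩ := hub K hK hKc
        refine Integrable.mono' (integrableOn_const (C := C) hKc.measure_lt_top.ne)
          hum.aestronglyMeasurable ?_
        rw [ae_restrict_iff' hKc.isClosed.measurableSet]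
        filter_upwards [hC] with x hx hxK
        rw [Real.norm_of_nonneg (hu0 x)]; exact hx hxK
      have hP : ∀ K ⊆ D (k + 1), IsCompact K →
          IntegrableOn (fun x => max (u x - w (k + 1) x) 0) K := fun K hK hKc =>
        (hS (k + 1)).integrableOn_posPart hum hu0 (hui K (hK.trans (hDΩ _)) hKc)
      have hwq : ∀ K ⊆ D (k + 1), IsCompact K → IntegrableOn (fun x => w (k + 1) x ^ q) K :=
        fun K _ hKc => (hS (k + 1)).integrableOn_rpow (by linarith) hKc
      refine (negLapLE_of_integral_eq (fun K _ hKc => (hS (k + 1)).integrableOn hKc)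
        (fun K hK hKc => (hwq K hK hKc).sub ((hP K hK hKc).const_mul _)) (hS (k + 1)).eq).mono_right
        (fun K hK hKc => (hwq K hK hKc).sub (Integrable.const_mul ?_ _)) (ae_of_all _ fun x _ => ?_)
      · refine (hP K hK hKc).mono' (((hum.min measurable_const).sub (hwm _)).max
          measurable_const).aestronglyMeasurable (ae_of_all _ fun x => ?_)
        rw [Real.norm_of_nonneg (le_max_right _ _)]
        exact max_le_max (by linarith [min_le_left (u x) (L k)]) le_rfl
      · have h1 : max (min (u x) (L k) - w (k + 1) x) 0 ≤ max (u x - w (k + 1) x) 0 :=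
          max_le_max (by linarith [min_le_left (u x) (L k)]) le_rfl
        have h2 := le_max_right (u x - w (k + 1) x) 0
        have h3 := mul_le_mul_of_nonneg_left h1 (hk0 k)
        simp only [Pi.sub_apply]
        push_cast
        linarith
    filter_upwards [ae_all_iff.2 hstep] with x hx
    exact monotone_nat_of_le_succ hx
  · exact le_of_penalized hq hΩ (hL0 k) hu0 huU hUm (fun h h0 hhL hn =>
      hcomp k Ω h hΩ (hcl k) h0 (fun x => (hhL x).trans (hLs k)) hn) hU

lemma exists_minimal (hq : 1 < q) (hΩ : IsOpen Ω) (hb : Bornology.IsBounded Ω)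
    (hum : Measurable u) (hu0 : ∀ x, 0 ≤ u x)
    (hub : ∀ K ⊆ Ω, IsCompact K → ∃ M : ℝ, 0 ≤ M ∧ ∀ᵐ x, x ∈ K → u x ≤ M)
    (hu : NegLapLE Ω u fun x => -u x ^ q) :
    ∃ v : Euc N → ℝ, Measurable v ∧ (∀ x, 0 ≤ v x) ∧
      (∀ K ⊆ Ω, IsCompact K → IntegrableOn v K) ∧
      (∀ K ⊆ Ω, IsCompact K → IntegrableOn (fun x => v x ^ q) K) ∧
      (∀ φ, IsTestFun Ω φ → ∫ x, v x ^ q * φ x = ∫ x, v x * laplacian φ x) ∧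
      (∀ᵐ x, x ∈ Ω → u x ≤ v x) ∧
      ∀ U : Euc N → ℝ, Measurable U → (∀ x, u x ≤ U x) →
        NegLapLE Ω (fun x => -U x) (fun x => U x ^ q) → ∀ᵐ x, v x ≤ U x := by
  obtain ⟨D, w, hDo, hDm, hDΩ, hDK, hS, hwD, hwmono, hwU⟩ :=
    exists_penalized_seq hq hΩ hb hum hu0 hub
  have hq0 : 0 ≤ q := by linarith
  have hrm : ∀ k, Measurable fun x => ENNReal.ofReal (w k x ^ q) := fun k =>
    ((hS k).measurable.pow_const q).ennreal_ofReal
  have hfin : ∀ K ⊆ Ω, IsCompact K →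
      ∫⁻ x in K, ⨆ k, ENNReal.ofReal (w k x ^ q) < ∞ := by
    intro K hK hKc
    obtain ⟨j, hj⟩ := hDK K hK hKc
    obtain ⟨A, -, hA⟩ := exists_integral_rpow_bound hq (hDo j) hum hu0 (hu.mono_set (hDΩ j)) hKc hj
    rw [lintegral_iSup' (fun k => (hrm k).aemeasurable) (ae_restrict_of_ae <| by
      filter_upwards [hwmono] with x hx k l hkl
      exact ENNReal.ofReal_le_ofReal (Real.rpow_le_rpow ((hS k).nonneg x) (hx hkl) hq0))]
    refine lt_of_le_of_lt (iSup_le fun k => ?_) (ENNReal.ofReal_lt_top (r := A))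
    calc ∫⁻ x in K, ENNReal.ofReal (w k x ^ q)
        ≤ ∫⁻ x in K, ENNReal.ofReal (w (max j k) x ^ q) := by
          refine lintegral_mono_ae (ae_restrict_of_ae ?_)
          filter_upwards [hwmono] with x hx
          exact ENNReal.ofReal_le_ofReal
            (Real.rpow_le_rpow ((hS k).nonneg x) (hx (le_max_right j k)) hq0)
      _ = ENNReal.ofReal (∫ x in K, w (max j k) x ^ q) :=
          (ofReal_integral_eq_lintegral_ofReal ((hS _).integrableOn_rpow hq0 hKc)
            (ae_of_all _ fun x => Real.rpow_nonneg ((hS _).nonneg x) q)).symm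
      _ ≤ ENNReal.ofReal A := ENNReal.ofReal_le_ofReal
          (hA _ _ (by simp) ((hS _).mono_set (hDm (le_max_left j k))))
  have hbdd : ∀ᵐ x, BddAbove (range fun k => w k x) := by
    obtain ⟨E, -, -, hEc, -, hEΩ, hEK⟩ := exists_exhaustion Ω hb hΩ
    have h1 : ∀ j, ∀ᵐ x, x ∈ closure (E j) → ⨆ k, ENNReal.ofReal (w k x ^ q) < ∞ := fun j => by
      have h := hfin (closure (E j)) ((hEc j).trans (hEΩ _)) (hb.subset (hEΩ j)).isCompact_closure
      have := ae_lt_top (Measurable.iSup hrm) h.ne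
      rwa [ae_restrict_iff' isClosed_closure.measurableSet] at this
    filter_upwards [ae_all_iff.2 h1] with x hx
    by_cases hxΩ : x ∈ Ω
    · obtain ⟨j, hj⟩ := hEK {x} (singleton_subset_iff.2 hxΩ) isCompact_singleton
      have h2 := hx j (subset_closure (hj rfl))
      refine ⟨1 + (⨆ k, ENNReal.ofReal (w k x ^ q)).toReal, ?_⟩
      rintro _ ⟨k, rfl⟩
      refine (le_one_add_rpow hq.le ((hS k).nonneg x)).trans ?_
      gcongr
      rw [← ENNReal.ofReal_le_iff_le_toReal h2.ne]
      exact le_iSup (fun k => ENNReal.ofReal (w k x ^ q)) k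
    · refine ⟨0, ?_⟩
      rintro _ ⟨k, rfl⟩
      exact (hwD k x fun h => hxΩ (hDΩ k h)).le
  set v : Euc N → ℝ := fun x => ⨆ k, w k x with hv
  have hvm : Measurable v := Measurable.iSup fun k => (hS k).measurable
  have hv0 : ∀ x, 0 ≤ v x := fun x => Real.iSup_nonneg fun k => (hS k).nonneg x
  have hwv : ∀ᵐ x, ∀ k, w k x ≤ v x := by
    filter_upwards [hbdd] with x hx k using le_ciSup hx k
  have hlim : ∀ᵐ x, Tendsto (fun k => w k x) atTop (𝓝 (v x)) := by
    filter_upwards [hbdd, hwmono] with x hx hm using tendsto_atTop_ciSup hm hx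
  have hvq : ∀ K ⊆ Ω, IsCompact K → IntegrableOn (fun x => v x ^ q) K := fun K hK hKc => by
    refine ⟨(hvm.pow_const q).aestronglyMeasurable, ?_⟩
    rw [hasFiniteIntegral_iff_ofReal (ae_of_all _ fun x => Real.rpow_nonneg (hv0 x) q)]
    refine lt_of_le_of_lt (lintegral_mono_ae (ae_restrict_of_ae ?_)) (hfin K hK hKc)
    filter_upwards [hlim] with x hx
    refine le_of_tendsto' (ENNReal.tendsto_ofReal (hx.rpow_const (Or.inr hq0))) fun k => ?_
    exact le_iSup (fun k => ENNReal.ofReal (w k x ^ q)) k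
  have hvi : ∀ K ⊆ Ω, IsCompact K → IntegrableOn v K := fun K hK hKc => by
    refine ((integrableOn_const (C := (1 : ℝ)) hKc.measure_lt_top.ne).add (hvq K hK hKc)).mono'
      hvm.aestronglyMeasurable (ae_of_all _ fun x => ?_)
    rw [Real.norm_of_nonneg (hv0 x)]
    exact le_one_add_rpow hq.le (hv0 x)
  have hpen : ∀ φ j, IsTestFun (D j) φ → (∀ x, 0 ≤ φ x) → ∃ A, 0 ≤ A ∧ ∀ k : ℕ, j ≤ k →
      ((k : ℝ) + 1) ^ 2 * ∫ x, max (u x - w k x) 0 * φ x ≤ A := fun φ j hφ hφ0 => by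
    obtain ⟨A, hA0, hA⟩ := exists_penalty_bound hq0 (hDo j) hum hu0 (hu.mono_set (hDΩ j)) hφ hφ0
    exact ⟨A, hA0, fun k hk => hA _ _ (by positivity) ((hS k).mono_set (hDm hk))⟩
  have hPi : ∀ k, ∀ K ⊆ Ω, IsCompact K → IntegrableOn (fun x => max (u x - w k x) 0) K :=
    fun k K hK hKc => (hS k).integrableOn_posPart hum hu0 (hu.1 K hK hKc)
  have hA0 : ∀ A : ℝ, Tendsto (fun k : ℕ => A * (1 / ((k : ℝ) + 1))) atTop (𝓝 0) := fun A => by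
    simpa using tendsto_one_div_add_atTop_nhds_zero_nat.const_mul A
  refine ⟨v, hvm, hv0, hvi, hvq, fun φ hφ => ?_, ?_, fun U hUm huU hU => ?_⟩
  · obtain ⟨j, hj⟩ := hDK _ hφ.2.2 hφ.2.1
    have hφj : IsTestFun (D j) φ := ⟨hφ.1, hφ.2.1, hj⟩
    have t1 : Tendsto (fun k => ∫ x, w k x ^ q * φ x) atTop (𝓝 (∫ x, v x ^ q * φ x)) := by
      refine tendsto_integral_of_dominated_convergence (fun x => |v x ^ q * φ x|)
        (fun k => (((hS k).measurable.pow_const q).mul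
          hφ.continuous.measurable).aestronglyMeasurable)
        (hφ.integrable_mul_of_locally hvq).abs (fun k => ?_) ?_
      · filter_upwards [hwv] with x hx
        rw [Real.norm_eq_abs, abs_mul, abs_mul, abs_of_nonneg (Real.rpow_nonneg (hv0 x) q),
          abs_of_nonneg (Real.rpow_nonneg ((hS k).nonneg x) q)]
        exact mul_le_mul_of_nonneg_right (Real.rpow_le_rpow ((hS k).nonneg x) (hx k) hq0)
          (abs_nonneg _)
      · filter_upwards [hlim] with x hx
        exact (hx.rpow_const (Or.inr hq0)).mul_const _
    have t2 : Tendsto (fun k => ∫ x, w k x * laplacian φ x) atTop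
        (𝓝 (∫ x, v x * laplacian φ x)) := by
      refine tendsto_integral_of_dominated_convergence (fun x => |v x * laplacian φ x|)
        (fun k => ((hS k).measurable.mul
          hφ.laplacian.continuous.measurable).aestronglyMeasurable)
        (hφ.laplacian.integrable_mul_of_locally hvi).abs (fun k => ?_) ?_
      · filter_upwards [hwv] with x hx
        rw [Real.norm_eq_abs, abs_mul, abs_mul, abs_of_nonneg (hv0 x),
          abs_of_nonneg ((hS k).nonneg x)]
        exact mul_le_mul_of_nonneg_right (hx k) (abs_nonneg _)
      · filter_upwards [hlim] with x hx
        exact hx.mul_const _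
    obtain ⟨χ, hχ, hχ0, hχφ⟩ := hφj.exists_dominating (hDo j)
    obtain ⟨A, hAnn, hA⟩ := hpen χ j hχ hχ0
    have t3 : Tendsto (fun k => (∫ x, w k x ^ q * φ x) - ∫ x, w k x * laplacian φ x) atTop
        (𝓝 0) := by
      refine squeeze_zero_norm' ?_ (hA0 A)
      filter_upwards [eventually_ge_atTop j] with k hk
      have i1 := hφ.integrable_mul_of_locally (hPi k)
      have i2 := hφ.integrable_mul_of_locally fun K _ hKc => (hS k).integrableOn_rpow hq0 hKc
      have e : (∫ x, w k x ^ q * φ x) - ∫ x, w k x * laplacian φ x =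
          ((k : ℝ) + 1) * ∫ x, max (u x - w k x) 0 * φ x := by
        rw [← (hS k).eq φ (hφj.mono (hDm hk)), ← integral_sub i2, ← integral_const_mul]
        · exact integral_congr_ae (ae_of_all _ fun x => by ring)
        · refine (i2.sub (i1.const_mul ((k : ℝ) + 1))).congr (ae_of_all _ fun x => ?_)
          simp only [Pi.sub_apply]; ring
      have hk1 : (0 : ℝ) < (k : ℝ) + 1 := by positivity
      have h1 : |∫ x, max (u x - w k x) 0 * φ x| ≤ ∫ x, max (u x - w k x) 0 * χ x := by
        refine (abs_integral_le_integral_abs).trans (integral_mono i1.abs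
          ((hχ.mono (hDΩ j)).integrable_mul_of_locally (hPi k)) fun x => ?_)
        simp only [abs_mul, abs_of_nonneg (le_max_right (u x - w k x) 0)]
        exact mul_le_mul_of_nonneg_left (hχφ x) (le_max_right _ _)
      rw [e, Real.norm_eq_abs, abs_mul, abs_of_pos hk1, mul_one_div, le_div_iff₀ hk1]
      have h2 := mul_le_mul_of_nonneg_left h1 (sq_nonneg ((k : ℝ) + 1))
      have h3 := hA k hk
      linarith
    exact sub_eq_zero.1 (tendsto_nhds_unique (t1.sub t2) t3)
  · obtain ⟨E, hEo, -, hEc, -, hEΩ, hEK⟩ := exists_exhaustion Ω hb hΩ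
    have h1 : ∀ j, ∀ᵐ x, x ∈ closure (E j) → u x ≤ v x := fun j => by
      have hcl : closure (E j) ⊆ Ω := (hEc j).trans (hEΩ _)
      have hcc : IsCompact (closure (E j)) := (hb.subset (hEΩ j)).isCompact_closure
      obtain ⟨l, hl⟩ := hDK _ hcl hcc
      obtain ⟨χ, hχ, hχ0, -, hχ1⟩ := exists_isTestFun_eq_one (hDo l) hcc hl
      obtain ⟨A, hAnn, hA⟩ := hpen χ l hχ hχ0
      have hχΩ := hχ.mono (hDΩ l)
      have hi : Integrable fun x => max (u x - v x) 0 * χ x := by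
        refine hχΩ.integrable_mul_of_locally fun K hK hKc => (hu.1 K hK hKc).mono'
          ((hum.sub hvm).max measurable_const).aestronglyMeasurable (ae_of_all _ fun x => ?_)
        rw [Real.norm_of_nonneg (le_max_right _ _)]
        exact max_le (by linarith [hv0 x]) (hu0 x)
      have h0 : ∀ x, 0 ≤ max (u x - v x) 0 * χ x := fun x =>
        mul_nonneg (le_max_right _ _) (hχ0 x)
      have h2 : ∫ x, max (u x - v x) 0 * χ x ≤ 0 := by
        refine ge_of_tendsto (hA0 A) ?_
        filter_upwards [eventually_ge_atTop l] with k hk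
        have hk1 : (1 : ℝ) ≤ (k : ℝ) + 1 := by simp
        have h3 : ∫ x, max (u x - v x) 0 * χ x ≤ ∫ x, max (u x - w k x) 0 * χ x := by
          refine integral_mono_ae hi (hχΩ.integrable_mul_of_locally (hPi k)) ?_
          filter_upwards [hwv] with x hx
          exact mul_le_mul_of_nonneg_right (max_le_max (by linarith [hx k]) le_rfl) (hχ0 x)
        rw [mul_one_div, le_div_iff₀ (by linarith)]
        have h4 := hA k hk
        have h5 : 0 ≤ ∫ x, max (u x - w k x) 0 * χ x :=
          integral_nonneg fun x => mul_nonneg (le_max_right _ _) (hχ0 x)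
        have h6 := mul_le_mul_of_nonneg_right h3 (show (0 : ℝ) ≤ (k : ℝ) + 1 by linarith)
        nlinarith [mul_nonneg h5 (mul_nonneg (show (0 : ℝ) ≤ (k : ℝ) + 1 by linarith)
          (sub_nonneg.2 hk1))]
      have h3 := (integral_eq_zero_iff_of_nonneg h0 hi).1
        (le_antisymm h2 (integral_nonneg h0))
      filter_upwards [h3] with x hx hxE
      simp only [hχ1 x hxE, mul_one, Pi.zero_apply] at hx
      linarith [le_max_left (u x - v x) 0]
    filter_upwards [ae_all_iff.2 h1] with x hx hxΩ
    obtain ⟨j, hj⟩ := hEK {x} (singleton_subset_iff.2 hxΩ) isCompact_singleton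
    exact hx j (subset_closure (hj rfl))
  · filter_upwards [ae_all_iff.2 (hwU U hUm huU hU)] with x hx
    exact ciSup_le hx

end Minimal

section Representatives

variable {N : ℕ} {u u₀ φ : Euc N → ℝ} {Ω K : Set (Euc N)} {q : ℝ}

lemma abs_rpow_sub_one_mul_self (hq : 1 < q) {t : ℝ} (ht : 0 ≤ t) : |t| ^ (q - 1) * t = t ^ q := by
  rw [abs_of_nonneg ht]
  rcases ht.eq_or_lt with rfl | h
  · simp [Real.zero_rpow (show q ≠ 0 by linarith)]
  · rw [← Real.rpow_add_one h.ne']; congr 1; ring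

lemma exists_measurable_nonneg_rep (hu : AEStronglyMeasurable u (volume.restrict Ω))
    (h0 : ∀ᵐ x ∂(volume.restrict Ω), 0 ≤ u x) :
    ∃ u₀ : Euc N → ℝ, Measurable u₀ ∧ (∀ x, 0 ≤ u₀ x) ∧ ∀ᵐ x ∂(volume.restrict Ω), u x = u₀ x := by
  refine ⟨fun x => max (hu.mk u x) 0, hu.stronglyMeasurable_mk.measurable.max measurable_const,
    fun x => le_max_right _ _, ?_⟩
  filter_upwards [hu.ae_eq_mk, h0] with x hx h
  rw [← hx, max_eq_left h]

lemma MemLqLoc.integrableOn_rep (hu : MemLqLoc q Ω u) (hq : 1 < q) (hum : Measurable u₀)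
    (hu0 : ∀ x, 0 ≤ u₀ x) (h : ∀ᵐ x ∂(volume.restrict Ω), u x = u₀ x) (hK : K ⊆ Ω)
    (hKc : IsCompact K) : IntegrableOn u₀ K ∧ IntegrableOn (fun x => u₀ x ^ q) K := by
  have h1 : IntegrableOn (fun x => u₀ x ^ q) K := by
    refine (hu.2 K hK hKc).congr ?_
    filter_upwards [ae_restrict_of_ae_restrict_of_subset hK h] with x hx
    rw [hx, abs_of_nonneg (hu0 x)]
  refine ⟨((integrableOn_const (C := (1 : ℝ)) hKc.measure_lt_top.ne).add h1).mono'
    hum.aestronglyMeasurable (ae_of_all _ fun x => ?_), h1⟩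
  rw [Real.norm_of_nonneg (hu0 x)]
  exact le_one_add_rpow hq.le (hu0 x)

lemma MemLqLoc.setIntegral_eq (hu : MemLqLoc q Ω u) (hq : 1 < q) (hum : Measurable u₀)
    (hu0 : ∀ x, 0 ≤ u₀ x) (h : ∀ᵐ x ∂(volume.restrict Ω), u x = u₀ x) (hφ : IsTestFun Ω φ) :
    ∫ x in Ω, (-(u x) * laplacian φ x + |u x| ^ (q - 1) * u x * φ x) =
      (∫ x, u₀ x ^ q * φ x) - ∫ x, u₀ x * laplacian φ x := by
  rw [← setIntegral_weak (fun K hK hKc => (hu.integrableOn_rep hq hum hu0 h hK hKc).1)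
    (fun K hK hKc => (hu.integrableOn_rep hq hum hu0 h hK hKc).2) hφ]
  refine integral_congr_ae ?_
  filter_upwards [h] with x hx
  rw [hx, abs_rpow_sub_one_mul_self hq (hu0 x)]

end Representatives

theorem stmt2 {N : ℕ} (hN : 2 ≤ N) (q : ℝ) (hq : ((N : ℝ) + 1) / ((N : ℝ) - 1) ≤ q)
    (Ω : Set (EuclideanSpace ℝ (Fin N))) (hΩ : IsOpen Ω) (hΩne : Ω.Nonempty)
    (hΩbd : Bornology.IsBounded Ω)
    (u : EuclideanSpace ℝ (Fin N) → ℝ) (huloc : MemLinftyLoc Ω u)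
    (hpos : ∀ᵐ x ∂(volume.restrict Ω), 0 ≤ u x)
    (hsub : IsSubsolution q Ω u) :
    ∃ v : EuclideanSpace ℝ (Fin N) → ℝ, IsSolution q Ω v ∧
      (∀ᵐ x ∂(volume.restrict Ω), u x ≤ v x) ∧
      ∀ U : EuclideanSpace ℝ (Fin N) → ℝ, IsSolution q Ω U →
        (∀ᵐ x ∂(volume.restrict Ω), u x ≤ U x) →
        (∀ᵐ x ∂(volume.restrict Ω), v x ≤ U x) := by
  have hN' : (2 : ℝ) ≤ N := by exact_mod_cast hN
  have hq1 : 1 < q := by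
    refine lt_of_lt_of_le ?_ hq
    rw [lt_div_iff₀ (by linarith)]
    linarith
  have hae : ∀ {p : EuclideanSpace ℝ (Fin N) → Prop},
      (∀ᵐ x ∂(volume.restrict Ω), p x) ↔ ∀ᵐ x, x ∈ Ω → p x := fun {p} =>
    ae_restrict_iff' hΩ.measurableSet
  obtain ⟨u₀, hum, hu0, hu⟩ := exists_measurable_nonneg_rep huloc.1 hpos
  have hui := fun K hK hKc => hsub.1.integrableOn_rep hq1 hum hu0 hu (K := K) hK hKc
  have hub : ∀ K ⊆ Ω, IsCompact K → ∃ M : ℝ, 0 ≤ M ∧ ∀ᵐ x, x ∈ K → u₀ x ≤ M := by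
    intro K hK hKc
    obtain ⟨M, hM⟩ := huloc.2 K hK hKc
    refine ⟨max M 0, le_max_right _ _, ?_⟩
    rw [ae_restrict_iff' hKc.isClosed.measurableSet] at hM
    filter_upwards [hM, hae.1 hu] with x h1 h2 hx
    rw [← h2 (hK hx)]
    exact ((le_abs_self _).trans (h1 hx)).trans (le_max_left _ _)
  have huN : NegLapLE Ω u₀ fun x => -u₀ x ^ q := by
    refine ⟨fun K hK hKc => (hui K hK hKc).1, fun K hK hKc => (hui K hK hKc).2.neg,
      fun φ hφ hφ0 => ?_⟩
    have h1 := hsub.2 φ hφ hφ0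
    rw [hsub.1.setIntegral_eq hq1 hum hu0 hu hφ] at h1
    simp only [neg_mul, integral_neg]
    linarith
  obtain ⟨v, hvm, hv0, hvi, hvq, hveq, huv, hvU⟩ := exists_minimal hq1 hΩ hΩbd hum hu0 hub huN
  have hvL : MemLqLoc q Ω v := by
    refine ⟨hvm.aestronglyMeasurable, fun K hK hKc => ?_⟩
    simpa only [abs_of_nonneg (hv0 _)] using hvq K hK hKc
  refine ⟨v, ⟨hvL, fun φ hφ => ?_⟩, ?_, fun U hU huU => ?_⟩
  · rw [hvL.setIntegral_eq hq1 hvm hv0 (ae_of_all _ fun _ => rfl) hφ, hveq φ hφ, sub_self]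
  · filter_upwards [hu, hae.2 huv] with x h1 h2
    rwa [h1]
  · obtain ⟨U₁, hU₁m, hU₁0, hU₁⟩ := exists_measurable_nonneg_rep hU.1.1 (by
      filter_upwards [hpos, huU] with x h1 h2 using h1.trans h2)
    have hUm : Measurable fun x => max (U₁ x) (u₀ x) := hU₁m.max hum
    have hU0 : ∀ x, 0 ≤ max (U₁ x) (u₀ x) := fun x => (hu0 x).trans (le_max_right _ _)
    have hUe : ∀ᵐ x ∂(volume.restrict Ω), U x = max (U₁ x) (u₀ x) := by
      filter_upwards [hu, huU, hU₁] with x h1 h2 h3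
      rw [← h3, ← h1, max_eq_left h2]
    have hUi := fun K hK hKc => hU.1.integrableOn_rep hq1 hUm hU0 hUe (K := K) hK hKc
    have h := hvU _ hUm (fun x => le_max_right _ _)
      (negLapLE_of_integral_eq (fun K hK hKc => (hUi K hK hKc).1)
        (fun K hK hKc => (hUi K hK hKc).2) fun φ hφ => by
          rw [← sub_eq_zero, ← hU.1.setIntegral_eq hq1 hUm hU0 hUe hφ, hU.2 φ hφ])
    filter_upwards [hUe, ae_restrict_of_ae h] with x h1 h2
    rwa [h1]
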